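/- arXiv:0906.4770 — 3 statements merged into one kernel-verified Lean document; each statement's English description precedes it below -/
import Mathlib

section
/- There exists a constant C < ∞ such that for all x ∈ ℝ and all s ∈ (0,1], the transition density satisfies p_s(x) ≤ C·max(ψ⁻¹(1/s), 1)/(1 + x²). -/
noncomputable def pdens (ψ : ℝ → ℝ) (s x : ℝ) : ℝ :=
  (1 / Real.pi) * ∫ p in Set.Ioi (0:ℝ), Real.cos (p * x) * Real.exp (-s * ψ p)

noncomputable def psiInv (ψ : ℝ → ℝ) (u : ℝ) : ℝ :=
  sInf {l : ℝ | 0 < l ∧ u ≤ ψ l}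

open MeasureTheory Set Filter in
/-- Lower growth bound from the doubling inequality and the derivative bound. -/
theorem aux_potter (ψ : ℝ → ℝ) (hpos : ∀ p : ℝ, p ≠ 0 → 0 < ψ p)
    (hdiff1 : ∀ p : ℝ, 0 < p → DifferentiableAt ℝ ψ p) (D₁ : ℝ)
    (hD1 : ∀ l : ℝ, 1 ≤ l → l * |deriv ψ l| ≤ D₁ * ψ l)
    (X : ℝ) (hX : 1 ≤ X) (hdbl : ∀ x, X ≤ x → 2 * ψ x ≤ ψ (2 * x)) :
    ∃ c : ℝ, 0 < c ∧ ∀ x y, X ≤ x → x ≤ y → c * (y / x) * ψ x ≤ ψ y := by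
  obtain ⟨N, hN⟩ := exists_nat_ge D₁
  have hmono : MonotoneOn (fun p => ψ p * p ^ (N + 1)) (Ici 1) := by
    have hd : ∀ p : ℝ, 0 < p → HasDerivAt (fun p => ψ p * p ^ (N + 1))
        (deriv ψ p * p ^ (N + 1) + ψ p * (((N + 1 : ℕ) : ℝ) * p ^ N)) p := by
      intro p hp
      have := (hdiff1 p hp).hasDerivAt.mul (hasDerivAt_pow (N + 1) p)
      exact this
    apply monotoneOn_of_deriv_nonneg (convex_Ici 1)
    · intro p hp
      exact (hd p (lt_of_lt_of_le one_pos hp)).continuousAt.continuousWithinAt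
    · intro p hp
      rw [interior_Ici] at hp
      exact (hd p (lt_trans one_pos hp)).differentiableAt.differentiableWithinAt
    · intro p hp
      rw [interior_Ici] at hp
      have hp1 : (1:ℝ) < p := hp
      have hp0 : 0 < p := by linarith
      rw [(hd p hp0).deriv]
      have h1 := hD1 p hp1.le
      have h2 : -|deriv ψ p| ≤ deriv ψ p := neg_abs_le _
      have h3 := hpos p hp0.ne'
      have h4 : 0 ≤ p * deriv ψ p + (N + 1) * ψ p := by nlinarith
      have h5 : deriv ψ p * p ^ (N + 1) + ψ p * (((N + 1 : ℕ) : ℝ) * p ^ N)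
          = p ^ N * (p * deriv ψ p + (N + 1) * ψ p) := by push_cast; ring
      rw [h5]
      positivity
  have hbase : ∀ x y, X ≤ x → x ≤ y → y ≤ 2 * x → ψ x ≤ 2 ^ (N + 1) * ψ y := by
    intro x y h1 h2 h3
    have hx0 : 0 < x := by linarith
    have h := hmono (show (1:ℝ) ≤ x by linarith) (show (1:ℝ) ≤ y by linarith) h2
    simp only at h
    have h4 : y ^ (N + 1) ≤ (2 * x) ^ (N + 1) := by gcongr; linarith
    have h5 := hpos y (by linarith)
    rw [mul_pow] at h4
    have h6 : ψ x * x ^ (N + 1) ≤ (2 ^ (N + 1) * ψ y) * x ^ (N + 1) := by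
      calc _ ≤ _ := h
        _ ≤ ψ y * (2 ^ (N + 1) * x ^ (N + 1)) := by gcongr
        _ = _ := by ring
    exact le_of_mul_le_mul_right h6 (by positivity)
  set c : ℝ := 1 / (2 * 2 ^ (N + 1)) with hc
  have hc0 : 0 < c := by positivity
  refine ⟨c, hc0, ?_⟩
  have key : ∀ n : ℕ, ∀ x y, X ≤ x → x ≤ y → y ≤ 2 ^ (n + 1) * x → c * (y / x) * ψ x ≤ ψ y := by
    intro n
    induction n with
    | zero =>
      intro x y h1 h2 h3
      have hx0 : 0 < x := by linarith
      have hψ := hpos x hx0.ne'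
      have h := hbase x y h1 h2 (by simpa using h3)
      have h4 : y / x ≤ 2 := by rw [div_le_iff₀ hx0]; simpa using h3
      calc c * (y / x) * ψ x ≤ c * 2 * ψ x := by gcongr
        _ ≤ c * 2 * (2 ^ (N + 1) * ψ y) := by gcongr
        _ = ψ y := by rw [hc]; field_simp
    | succ n ih =>
      intro x y h1 h2 h3
      have hx0 : 0 < x := by linarith
      by_cases hy : y ≤ 2 ^ (n + 1) * x
      · exact ih x y h1 h2 hy
      · push Not at hy
        have h2n : (2:ℝ) ≤ 2 ^ (n + 1) := by
          calc (2:ℝ) = 2 ^ 1 := by norm_num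
            _ ≤ _ := by gcongr <;> simp
        have h5 : 2 * x ≤ y := by nlinarith
        have h6 := ih x (y / 2) h1 (by linarith) (by rw [pow_succ] at h3; linarith)
        have h7 := hdbl (y / 2) (by linarith)
        rw [show 2 * (y / 2) = y by ring] at h7
        calc c * (y / x) * ψ x = 2 * (c * (y / 2 / x) * ψ x) := by ring
          _ ≤ 2 * ψ (y / 2) := by linarith
          _ ≤ _ := h7
  intro x y h1 h2
  have hx0 : 0 < x := by linarith
  obtain ⟨n, hn⟩ := pow_unbounded_of_one_lt (y / x) (one_lt_two)
  apply key n x y h1 h2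
  rw [div_lt_iff₀ hx0] at hn
  have : (2:ℝ) ^ n * x ≤ 2 ^ (n + 1) * x := by rw [pow_succ]; nlinarith [pow_pos (two_pos (α := ℝ)) n, mul_pos (pow_pos (two_pos (α := ℝ)) n) hx0]
  linarith

open MeasureTheory Set Filter in
/-- Exponential domination of the characteristic function. -/
theorem aux_dom (ψ : ℝ → ℝ) (hpos : ∀ p : ℝ, p ≠ 0 → 0 < ψ p)
    (C₀ : ℝ) (hC0 : ∀ p : ℝ, ψ p ≤ C₀ * p ^ 2)
    (X : ℝ) (hX : 1 ≤ X) (c : ℝ) (hc : 0 < c)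
    (hgrow : ∀ x y, X ≤ x → x ≤ y → c * (y / x) * ψ x ≤ ψ y) :
    ∃ d K : ℝ, 0 < d ∧ 0 < K ∧ ∀ s l, 0 < s → 0 < l → 1 / s ≤ ψ l →
      ∃ M, 0 < M ∧ M ≤ K * max l 1 ∧
        ∀ p, 0 < p → Real.exp (-s * ψ p) ≤ Real.exp d * Real.exp (-(d / M) * p) := by
  have hψX := hpos X (by linarith)
  have hC0p : 0 < C₀ := by
    have := hC0 1
    have := hpos 1 one_ne_zero
    linarith
  have hX0 : 0 < X := by linarith
  set e : ℝ := min 1 (ψ X / (C₀ * X ^ 2)) with he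
  have he0 : 0 < e := by positivity
  have hd : 0 < c * e := by positivity
  refine ⟨c * e, X, hd, hX0, ?_⟩
  intro s l hs hl hsl
  refine ⟨max l X, by positivity, ?_, ?_⟩
  · apply max_le
    · calc l ≤ max l 1 := le_max_left _ _
        _ ≤ X * max l 1 := le_mul_of_one_le_left (by positivity) hX
    · exact le_mul_of_one_le_right hX0.le (le_max_right _ _)
  have hM0 : 0 < max l X := by positivity
  have hsM : e ≤ s * ψ (max l X) := by
    rw [div_le_iff₀ hs] at hsl
    rcases le_total X l with h | h
    · rw [max_eq_left h]
      have := min_le_left 1 (ψ X / (C₀ * X ^ 2))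
      rw [← he] at this
      linarith
    · rw [max_eq_right h]
      have h1 := min_le_right 1 (ψ X / (C₀ * X ^ 2))
      rw [← he] at h1
      refine h1.trans ?_
      rw [div_le_iff₀ (by positivity)]
      have h2 : ψ l ≤ C₀ * X ^ 2 := (hC0 l).trans (by gcongr)
      have h3 : 1 ≤ s * (C₀ * X ^ 2) := by nlinarith
      nlinarith
  intro p hp
  rw [← Real.exp_add]
  apply Real.exp_le_exp.mpr
  rcases le_total p (max l X) with h | h
  · have h1 : p / max l X ≤ 1 := by rw [div_le_one hM0]; exact h
    have h2 : 0 ≤ s * ψ p := mul_nonneg hs.le (hpos p hp.ne').le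
    have h3 : c * e / max l X * p = c * e * (p / max l X) := by ring
    nlinarith
  · have h1 := hgrow _ p (le_max_right l X) h
    have h3 : c * e / max l X * p = c * (p / max l X) * e := by ring
    have h4 : 0 < c * (p / max l X) := by positivity
    have h5 : c * (p / max l X) * e ≤ c * (p / max l X) * (s * ψ (max l X)) := by gcongr
    have h6 : s * (c * (p / max l X) * ψ (max l X)) ≤ s * ψ p := by gcongr
    nlinarith

open MeasureTheory Set Filter in
/-- Boundedness of the derivative near the origin. -/
theorem aux_deriv_bdd (ψ : ℝ → ℝ)
    (hdiff2 : ∀ p : ℝ, 0 < p → DifferentiableAt ℝ (deriv ψ) p)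
    (hint2 : IntegrableOn (fun l : ℝ => |deriv (deriv ψ) l|) (Ioc (0:ℝ) 1)) :
    ∀ a : ℝ, 0 < a → a ≤ 1 →
      |deriv ψ a| ≤ |deriv ψ 1| + ∫ l in Ioc (0:ℝ) 1, |deriv (deriv ψ) l| := by
  intro a ha ha1
  have hsub : Ioc a 1 ⊆ Ioc (0:ℝ) 1 := Ioc_subset_Ioc_left ha.le
  have hi : IntegrableOn (deriv (deriv ψ)) (Ioc (0:ℝ) 1) :=
    (integrable_norm_iff (measurable_deriv _).aestronglyMeasurable).mp hint2
  have hii : IntervalIntegrable (deriv (deriv ψ)) volume a 1 := by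
    rw [intervalIntegrable_iff_integrableOn_Ioc_of_le ha1]
    exact hi.mono_set hsub
  have h := intervalIntegral.integral_eq_sub_of_hasDerivAt (f := deriv ψ)
    (f' := deriv (deriv ψ)) (a := a) (b := 1) (by
      intro p hp
      rw [uIcc_of_le ha1] at hp
      exact (hdiff2 p (lt_of_lt_of_le ha hp.1)).hasDerivAt) hii
  rw [intervalIntegral.integral_of_le ha1] at h
  have h1 : |∫ l in Ioc a 1, deriv (deriv ψ) l| ≤ ∫ l in Ioc a 1, |deriv (deriv ψ) l| :=
    abs_integral_le_integral_abs
  have h2 : ∫ l in Ioc a 1, |deriv (deriv ψ) l| ≤ ∫ l in Ioc (0:ℝ) 1, |deriv (deriv ψ) l| :=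
    setIntegral_mono_set hint2 (Eventually.of_forall fun _ => abs_nonneg _)
      (LE.le.eventuallyLE hsub)
  rw [h] at h1
  have h3 : |deriv ψ a| ≤ |deriv ψ 1| + |deriv ψ 1 - deriv ψ a| := by
    have := abs_sub (deriv ψ 1) (deriv ψ 1 - deriv ψ a)
    simpa using this
  linarith

theorem aux_exp1 (u : ℝ) : u * Real.exp (-u) ≤ 1 := by
  have h := Real.add_one_le_exp u
  rw [Real.exp_neg, ← div_eq_mul_inv, div_le_one (Real.exp_pos _)]
  linarith

theorem aux_exp2 (u : ℝ) (hu : 0 ≤ u) : u ^ 2 * Real.exp (-u) ≤ 2 := by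
  have h := Real.quadratic_le_exp_of_nonneg hu
  rw [Real.exp_neg, ← div_eq_mul_inv, div_le_iff₀ (Real.exp_pos _)]
  linarith

open MeasureTheory Set Filter in
/-- Uniform dominating function for the second derivative. -/
theorem aux_second (ψ : ℝ → ℝ) (hnonneg : ∀ p : ℝ, 0 ≤ ψ p)
    (D₁ D₂ : ℝ) (hD₁ : 0 ≤ D₁)
    (hD1 : ∀ l : ℝ, 1 ≤ l → l * |deriv ψ l| ≤ D₁ * ψ l)
    (hD2 : ∀ l : ℝ, 1 ≤ l → l ^ 2 * |deriv (deriv ψ) l| ≤ D₂ * ψ l) (hD₂ : 0 ≤ D₂)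
    (hint1 : IntegrableOn (fun l : ℝ => (deriv ψ l) ^ 2) (Ioc (0:ℝ) 1))
    (hint2 : IntegrableOn (fun l : ℝ => |deriv (deriv ψ) l|) (Ioc (0:ℝ) 1)) :
    ∃ H : ℝ → ℝ, IntegrableOn H (Ioi 0) ∧ (∀ p, 0 ≤ H p) ∧ ∀ s, 0 < s → s ≤ 1 → ∀ p, 0 < p →
      |(s ^ 2 * (deriv ψ p) ^ 2 - s * deriv (deriv ψ) p) * Real.exp (-s * ψ p)| ≤ H p := by
  refine ⟨fun p => if p ≤ 1 then (deriv ψ p) ^ 2 + |deriv (deriv ψ) p|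
    else (2 * D₁ ^ 2 + D₂) * p ^ (-2 : ℝ), ?_, ?_, ?_⟩
  · rw [← Ioc_union_Ioi_eq_Ioi (zero_le_one (α := ℝ))]
    apply IntegrableOn.union
    · refine (hint1.add hint2).congr_fun ?_ measurableSet_Ioc
      intro p hp
      simp [hp.2]
    · have : IntegrableOn (fun p : ℝ => (2 * D₁ ^ 2 + D₂) * p ^ (-2 : ℝ)) (Ioi 1) :=
        ((integrableOn_Ioi_rpow_of_lt (by norm_num) one_pos).const_mul _)
      refine this.congr_fun ?_ measurableSet_Ioi
      intro p hp
      have : ¬ p ≤ 1 := not_le.mpr hp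
      simp [this]
  · intro p
    dsimp only
    split_ifs with h
    · positivity
    · have : 0 < p := by linarith
      positivity
  · intro s hs hs1 p hp
    have hE : Real.exp (-s * ψ p) ≤ 1 := by
      rw [Real.exp_le_one_iff]
      nlinarith [hnonneg p]
    have hE0 := Real.exp_pos (-s * ψ p)
    have h0 : |(s ^ 2 * (deriv ψ p) ^ 2 - s * deriv (deriv ψ) p) * Real.exp (-s * ψ p)|
        ≤ (s ^ 2 * (deriv ψ p) ^ 2 + s * |deriv (deriv ψ) p|) * Real.exp (-s * ψ p) := by
      rw [abs_mul, abs_of_pos hE0]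
      gcongr
      refine (abs_sub _ _).trans ?_
      rw [abs_mul s, abs_of_pos hs, abs_of_nonneg (by positivity : 0 ≤ s ^ 2 * (deriv ψ p) ^ 2)]
    refine h0.trans ?_
    dsimp only
    split_ifs with h
    · calc _ ≤ (s ^ 2 * (deriv ψ p) ^ 2 + s * |deriv (deriv ψ) p|) * 1 := by gcongr
        _ ≤ (1 ^ 2 * (deriv ψ p) ^ 2 + 1 * |deriv (deriv ψ) p|) * 1 := by gcongr
        _ = _ := by ring
    · push Not at h
      have hu : 0 ≤ s * ψ p := mul_nonneg hs.le (hnonneg p)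
      have e1 := aux_exp1 (s * ψ p)
      have e2 := aux_exp2 (s * ψ p) hu
      rw [← neg_mul] at e1 e2
      have a1 := hD1 p h.le
      have a2 := hD2 p h.le
      have a3 : p ^ 2 * (deriv ψ p) ^ 2 ≤ (D₁ * ψ p) ^ 2 := by
        rw [← sq_abs (deriv ψ p), ← mul_pow]
        gcongr
      rw [Real.rpow_neg hp.le, Real.rpow_two, ← div_eq_mul_inv, le_div_iff₀ (by positivity)]
      calc _ = (s ^ 2 * (p ^ 2 * (deriv ψ p) ^ 2) + s * (p ^ 2 * |deriv (deriv ψ) p|))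
              * Real.exp (-s * ψ p) := by ring
        _ ≤ (s ^ 2 * (D₁ * ψ p) ^ 2 + s * (D₂ * ψ p)) * Real.exp (-s * ψ p) := by gcongr
        _ = D₁ ^ 2 * ((s * ψ p) ^ 2 * Real.exp (-s * ψ p))
              + D₂ * ((s * ψ p) * Real.exp (-s * ψ p)) := by ring
        _ ≤ D₁ ^ 2 * 2 + D₂ * 1 := by gcongr
        _ = _ := by ring

open MeasureTheory Set Filter in
/-- The twofold integration by parts. -/
theorem aux_ibp (ψ : ℝ → ℝ) (hnonneg : ∀ p : ℝ, 0 ≤ ψ p)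
    (hdiff1 : ∀ p : ℝ, 0 < p → DifferentiableAt ℝ ψ p)
    (hdiff2 : ∀ p : ℝ, 0 < p → DifferentiableAt ℝ (deriv ψ) p)
    (D₁ : ℝ) (hD₁ : 0 ≤ D₁)
    (hD1 : ∀ l : ℝ, 1 ≤ l → l * |deriv ψ l| ≤ D₁ * ψ l)
    (s x : ℝ) (hs : 0 < s) (hs1 : s ≤ 1)
    (hmeas : Measurable ψ)
    (hf : IntegrableOn (fun p => Real.exp (-s * ψ p)) (Ioi 0))
    (hlim : Tendsto (fun p => Real.exp (-s * ψ p)) atTop (nhds 0))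
    (H : ℝ → ℝ) (hH : IntegrableOn H (Ioi 0)) (hH0 : ∀ p, 0 ≤ H p)
    (hHb : ∀ p, 0 < p →
      |(s ^ 2 * (deriv ψ p) ^ 2 - s * deriv (deriv ψ) p) * Real.exp (-s * ψ p)| ≤ H p)
    (B : ℝ) (hB : ∀ a, 0 < a → a ≤ 1 → |deriv ψ a| ≤ B) :
    x ^ 2 * |∫ p in Ioi (0:ℝ), Real.cos (p * x) * Real.exp (-s * ψ p)|
      ≤ B + ∫ p in Ioi (0:ℝ), H p := by
  set f : ℝ → ℝ := fun p => Real.exp (-s * ψ p) with hfdef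
  set f1 : ℝ → ℝ := fun p => -s * deriv ψ p * f p with hf1def
  set f2 : ℝ → ℝ := fun p => (s ^ 2 * (deriv ψ p) ^ 2 - s * deriv (deriv ψ) p) * f p with hf2def
  have hf01 : ∀ p, f p ≤ 1 := by
    intro p
    simp only [hfdef, Real.exp_le_one_iff]
    nlinarith [hnonneg p]
  have hfpos : ∀ p, 0 < f p := fun p => Real.exp_pos _
  have hcf : IntegrableOn (fun p => Real.cos (p * x) * f p) (Ioi 0) := by
    refine Integrable.mono' hf (by fun_prop) (Eventually.of_forall fun p => ?_)
    rw [Real.norm_eq_abs, abs_mul, abs_of_pos (hfpos p)]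
    exact mul_le_of_le_one_left (hfpos p).le (Real.abs_cos_le_one _)
  have hm1 : Measurable (deriv ψ) := measurable_deriv _
  have hm2 : Measurable (deriv (deriv ψ)) := measurable_deriv _
  have hcf2 : IntegrableOn (fun p => Real.cos (p * x) * f2 p) (Ioi 0) := by
    refine Integrable.mono' hH (by fun_prop) ?_
    filter_upwards [ae_restrict_mem measurableSet_Ioi] with p hp
    rw [Real.norm_eq_abs, abs_mul]
    exact (mul_le_of_le_one_left (abs_nonneg _) (Real.abs_cos_le_one _)).trans (hHb p hp)
  have hfd : ∀ p, 0 < p → HasDerivAt f (f1 p) p := by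
    intro p hp
    have := ((hdiff1 p hp).hasDerivAt.const_mul (-s)).exp
    exact this.congr_deriv (by simp only [hf1def, hfdef]; ring)
  have hf1d : ∀ p, 0 < p → HasDerivAt f1 (f2 p) p := by
    intro p hp
    have := ((hdiff2 p hp).hasDerivAt.const_mul (-s)).mul (hfd p hp)
    exact this.congr_deriv (by simp only [hf2def, hf1def]; ring)
  have hf1lim : Tendsto f1 atTop (nhds 0) := by
    have h0 : Tendsto (fun p : ℝ => D₁ * p⁻¹) atTop (nhds 0) := by
      simpa using tendsto_inv_atTop_zero.const_mul D₁
    refine squeeze_zero_norm' ?_ h0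
    filter_upwards [eventually_ge_atTop (1:ℝ)] with p hp
    have hp0 : 0 < p := by linarith
    have e1 := aux_exp1 (s * ψ p)
    rw [← neg_mul] at e1
    rw [Real.norm_eq_abs, ← div_eq_mul_inv, le_div_iff₀ hp0]
    simp only [hf1def]
    rw [abs_mul, abs_mul, abs_neg, abs_of_pos hs, abs_of_pos (hfpos p)]
    have hfp := hfpos p
    calc s * |deriv ψ p| * f p * p = s * (p * |deriv ψ p|) * f p := by ring
      _ ≤ s * (D₁ * ψ p) * f p :=
          mul_le_mul_of_nonneg_right (mul_le_mul_of_nonneg_left (hD1 p hp) hs.le) hfp.le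
      _ = D₁ * (s * ψ p * f p) := by ring
      _ ≤ D₁ * 1 := by gcongr
      _ = D₁ := by ring
  set G : ℝ → ℝ := fun p => x * (Real.sin (p * x) * f p) + Real.cos (p * x) * f1 p with hG
  have hGd : ∀ p, 0 < p → HasDerivAt G
      (x ^ 2 * (Real.cos (p * x) * f p) + Real.cos (p * x) * f2 p) p := by
    intro p hp
    have hl : HasDerivAt (fun p => p * x) x p := by
      simpa using (hasDerivAt_id p).mul_const x
    have h1 := (hl.sin.mul (hfd p hp)).const_mul x
    have h2 := hl.cos.mul (hf1d p hp)
    exact (h1.add h2).congr_deriv (by ring)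
  have hGlim : Tendsto G atTop (nhds 0) := by
    have h1 : Tendsto (fun p => Real.sin (p * x) * f p) atTop (nhds 0) := by
      refine squeeze_zero_norm (fun p => ?_) hlim
      rw [Real.norm_eq_abs, abs_mul, abs_of_pos (hfpos p)]
      exact mul_le_of_le_one_left (hfpos p).le (Real.abs_sin_le_one _)
    have h2 : Tendsto (fun p => Real.cos (p * x) * f1 p) atTop (nhds 0) := by
      refine squeeze_zero_norm (fun p => ?_) (by simpa using hf1lim.abs)
      rw [Real.norm_eq_abs, abs_mul]
      exact mul_le_of_le_one_left (abs_nonneg _) (Real.abs_cos_le_one _)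
    simpa using (h1.const_mul x).add h2
  have hmain : ∀ a : ℝ, 0 < a → a ≤ 1 →
      x ^ 2 * |∫ p in Ioi (0:ℝ), Real.cos (p * x) * f p|
        ≤ (B + ∫ p in Ioi (0:ℝ), H p) + 2 * x ^ 2 * a := by
    intro a ha ha1
    have hsub : Ioi a ⊆ Ioi (0:ℝ) := Ioi_subset_Ioi ha.le
    have i1 := hcf.mono_set hsub
    have i2 := hcf2.mono_set hsub
    have hI := integral_Ioi_of_hasDerivAt_of_tendsto' (a := a) (f := G)
      (fun p hp => hGd p (lt_of_lt_of_le ha hp)) ((i1.const_mul (x ^ 2)).add i2) hGlim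
    rw [integral_add (i1.const_mul (x ^ 2)) i2, integral_const_mul] at hI
    have hb2 : |∫ p in Ioi a, Real.cos (p * x) * f2 p| ≤ ∫ p in Ioi (0:ℝ), H p := by
      calc _ ≤ ∫ p in Ioi a, |Real.cos (p * x) * f2 p| := abs_integral_le_integral_abs
        _ ≤ ∫ p in Ioi a, H p := by
          refine setIntegral_mono_on i2.abs (hH.mono_set hsub) measurableSet_Ioi ?_
          intro p hp
          rw [abs_mul]
          exact (mul_le_of_le_one_left (abs_nonneg _) (Real.abs_cos_le_one _)).trans
            (hHb p (hsub hp))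
        _ ≤ _ := setIntegral_mono_set hH (Eventually.of_forall hH0)
            (LE.le.eventuallyLE hsub)
    have hGa : |G a| ≤ x ^ 2 * a + B := by
      simp only [hG]
      refine (abs_add_le _ _).trans ?_
      have t1 : |Real.sin (a * x)| ≤ a * |x| := by
        have := Real.abs_sin_le_abs (x := a * x)
        rwa [abs_mul a, abs_of_pos ha] at this
      have t2 : |x * (Real.sin (a * x) * f a)| ≤ x ^ 2 * a := by
        rw [abs_mul, abs_mul, abs_of_pos (hfpos a)]
        have := hfpos a
        calc |x| * (|Real.sin (a * x)| * f a) ≤ |x| * ((a * |x|) * 1) := by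
              gcongr; exact hf01 a
          _ = |x| ^ 2 * a := by ring
          _ = _ := by rw [sq_abs]
      have t3 : |Real.cos (a * x) * f1 a| ≤ B := by
        rw [abs_mul]
        refine (mul_le_of_le_one_left (abs_nonneg _) (Real.abs_cos_le_one _)).trans ?_
        simp only [hf1def]
        rw [abs_mul, abs_mul, abs_neg, abs_of_pos hs, abs_of_pos (hfpos a)]
        have := hfpos a
        calc s * |deriv ψ a| * f a ≤ 1 * |deriv ψ a| * 1 := by gcongr; exact hf01 a
          _ ≤ B := by simpa using hB a ha ha1
      linarith
    have hsplit : ∫ p in Ioi (0:ℝ), Real.cos (p * x) * f p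
        = (∫ p in Ioc (0:ℝ) a, Real.cos (p * x) * f p)
          + ∫ p in Ioi a, Real.cos (p * x) * f p := by
      rw [← Ioc_union_Ioi_eq_Ioi ha.le]
      exact setIntegral_union (Ioc_disjoint_Ioi le_rfl) measurableSet_Ioi
        (hcf.mono_set Ioc_subset_Ioi_self) i1
    have hsmall : |∫ p in Ioc (0:ℝ) a, Real.cos (p * x) * f p| ≤ a := by
      have := norm_setIntegral_le_of_norm_le_const (μ := volume) (s := Ioc (0:ℝ) a) (C := 1)
        (f := fun p => Real.cos (p * x) * f p) (by simp) (by
          intro p _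
          rw [Real.norm_eq_abs, abs_mul, abs_of_pos (hfpos p)]
          exact mul_le_one₀ (Real.abs_cos_le_one _) (hfpos p).le (hf01 p))
      simpa [Real.norm_eq_abs, ha.le] using this
    have hlarge : x ^ 2 * |∫ p in Ioi a, Real.cos (p * x) * f p|
        ≤ x ^ 2 * a + B + ∫ p in Ioi (0:ℝ), H p := by
      have : x ^ 2 * |∫ p in Ioi a, Real.cos (p * x) * f p|
          = |x ^ 2 * ∫ p in Ioi a, Real.cos (p * x) * f p| := by
        rw [abs_mul, abs_of_nonneg (sq_nonneg x)]
      rw [this]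
      have e : x ^ 2 * ∫ p in Ioi a, Real.cos (p * x) * f p
          = -G a - ∫ p in Ioi a, Real.cos (p * x) * f2 p := by linarith
      rw [e]
      refine (abs_sub _ _).trans ?_
      rw [abs_neg]
      linarith
    rw [hsplit]
    calc _ ≤ x ^ 2 * (|∫ p in Ioc (0:ℝ) a, Real.cos (p * x) * f p|
          + |∫ p in Ioi a, Real.cos (p * x) * f p|) := by gcongr; exact abs_add_le _ _
      _ ≤ x ^ 2 * a + (x ^ 2 * a + B + ∫ p in Ioi (0:ℝ), H p) := by
          rw [mul_add]; gcongr
      _ = _ := by ring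
  have hten : Tendsto (fun a : ℝ => (B + ∫ p in Ioi (0:ℝ), H p) + 2 * x ^ 2 * a)
      (nhdsWithin 0 (Ioi 0)) (nhds (B + ∫ p in Ioi (0:ℝ), H p)) := by
    have : Continuous (fun a : ℝ => (B + ∫ p in Ioi (0:ℝ), H p) + 2 * x ^ 2 * a) := by fun_prop
    simpa using (this.tendsto 0).mono_left nhdsWithin_le_nhds
  refine ge_of_tendsto hten ?_
  filter_upwards [Ioc_mem_nhdsGT (one_pos (α := ℝ))] with a ha
  exact hmain a ha.1 ha.2

theorem stmt_0
    (β : ℝ) (hβ1 : 1 < β) (hβ2 : β ≤ 2)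
    (ψ : ℝ → ℝ)
    (hmeas : Measurable ψ)
    (heven : ∀ p : ℝ, ψ (-p) = ψ p)
    (hnonneg : ∀ p : ℝ, 0 ≤ ψ p)
    (hpos : ∀ p : ℝ, p ≠ 0 → 0 < ψ p)
    (hRV : ∀ l : ℝ, 0 < l →
      Filter.Tendsto (fun x => ψ (l * x) / ψ x) Filter.atTop (nhds (l ^ β)))
    (hdiff1 : ∀ p : ℝ, 0 < p → DifferentiableAt ℝ ψ p)
    (hdiff2 : ∀ p : ℝ, 0 < p → DifferentiableAt ℝ (deriv ψ) p)
    (D₁ D₂ : ℝ)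
    (hD1 : ∀ l : ℝ, 1 ≤ l → l * |deriv ψ l| ≤ D₁ * ψ l)
    (hD2 : ∀ l : ℝ, 1 ≤ l → l ^ 2 * |deriv (deriv ψ) l| ≤ D₂ * ψ l)
    (hint1 : MeasureTheory.IntegrableOn (fun l : ℝ => (deriv ψ l) ^ 2) (Set.Ioc (0:ℝ) 1))
    (hint2 : MeasureTheory.IntegrableOn (fun l : ℝ => |deriv (deriv ψ) l|) (Set.Ioc (0:ℝ) 1))
    (hint3 : MeasureTheory.IntegrableOn (fun l : ℝ => ψ l / l) (Set.Ioc (0:ℝ) 1))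
    (C₀ : ℝ) (hC0 : ∀ p : ℝ, ψ p ≤ C₀ * p ^ 2)
    (hliminf : 0 < Filter.liminf (fun p : ℝ => ψ p / p ^ 2) (nhdsWithin (0:ℝ) ({0}ᶜ))) :
    ∃ C : ℝ, ∀ x : ℝ, ∀ s : ℝ, 0 < s → s ≤ 1 →
      pdens ψ s x ≤ C * max (psiInv ψ (1 / s)) 1 / (1 + x ^ 2) := by
  obtain ⟨X, hX1, hdbl⟩ : ∃ X : ℝ, 1 ≤ X ∧ ∀ x, X ≤ x → 2 * ψ x ≤ ψ (2 * x) := by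
    have h2 : (2:ℝ) < 2 ^ β := by
      calc (2:ℝ) = 2 ^ (1:ℝ) := by simp
        _ < 2 ^ β := Real.rpow_lt_rpow_of_exponent_lt one_lt_two hβ1
    have := (hRV 2 two_pos).eventually (lt_mem_nhds h2)
    obtain ⟨X, hX⟩ := Filter.eventually_atTop.mp this
    refine ⟨max X 1, le_max_right _ _, fun x hx => ?_⟩
    have h3 := hX x ((le_max_left _ _).trans hx)
    have hx1 : 1 ≤ x := (le_max_right _ _).trans hx
    rw [lt_div_iff₀ (hpos x (by linarith))] at h3
    exact h3.le
  obtain ⟨c, hc, hgrow⟩ := aux_potter ψ hpos hdiff1 D₁ hD1 X hX1 hdbl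
  obtain ⟨d, K, hd, hK, hdom⟩ := aux_dom ψ hpos C₀ hC0 X hX1 c hc hgrow
  have hψ1 := hpos 1 one_ne_zero
  have hD₁ : 0 ≤ D₁ := by
    have h := hD1 1 le_rfl
    have h1 : 0 ≤ D₁ * ψ 1 := le_trans (by positivity) h
    exact nonneg_of_mul_nonneg_left h1 hψ1
  have hD₂ : 0 ≤ D₂ := by
    have h := hD2 1 le_rfl
    have h1 : 0 ≤ D₂ * ψ 1 := le_trans (by positivity) h
    exact nonneg_of_mul_nonneg_left h1 hψ1
  obtain ⟨H, hH, hH0, hHb⟩ := aux_second ψ hnonneg D₁ D₂ hD₁ hD1 hD2 hD₂ hint1 hint2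
  have hBd := aux_deriv_bdd ψ hdiff2 hint2
  set B : ℝ := |deriv ψ 1| + ∫ l in Set.Ioc (0:ℝ) 1, |deriv (deriv ψ) l| with hBdef
  set A : ℝ := B + ∫ p in Set.Ioi (0:ℝ), H p with hA
  have hA0 : 0 ≤ A := by
    have h1 : 0 ≤ ∫ p in Set.Ioi (0:ℝ), H p := MeasureTheory.integral_nonneg hH0
    have h2 : 0 ≤ ∫ l in Set.Ioc (0:ℝ) 1, |deriv (deriv ψ) l| :=
      MeasureTheory.integral_nonneg fun _ => abs_nonneg _
    positivity
  set K1 : ℝ := Real.exp d * (2 * K / d) with hK1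
  refine ⟨(1 / Real.pi) * (K1 + A), ?_⟩
  intro x s hs hs1
  set R := psiInv ψ (1 / s) with hR
  have hne : {l : ℝ | 0 < l ∧ 1 / s ≤ ψ l}.Nonempty := by
    have hX0 : 0 < X := by linarith
    have hψX := hpos X hX0.ne'
    set y := max X (X / (s * c * ψ X)) with hy
    have h1 := hgrow X y le_rfl (le_max_left _ _)
    refine ⟨y, lt_of_lt_of_le hX0 (le_max_left _ _), le_trans ?_ h1⟩
    have h2 : X / (s * c * ψ X) ≤ y := le_max_right _ _
    calc 1 / s = c * (X / (s * c * ψ X) / X) * ψ X := by field_simp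
      _ ≤ _ := by gcongr
  obtain ⟨l, ⟨hl0, hl⟩, hlR⟩ := exists_lt_of_csInf_lt hne (show R < R + 1 by linarith)
  obtain ⟨M, hM0, hM, hE⟩ := hdom s l hs hl0 hl
  set m := max R 1 with hm
  have hm1 : 1 ≤ m := le_max_right _ _
  have hlm : max l 1 ≤ 2 * m := by
    have : R ≤ m := le_max_left _ _
    exact max_le (by linarith) (by linarith)
  have hMm : M ≤ 2 * K * m := by nlinarith
  have hdM : 0 < d / M := by positivity
  have hexp : MeasureTheory.IntegrableOn
      (fun p => Real.exp d * Real.exp (-(d / M) * p)) (Set.Ioi (0:ℝ)) :=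
    (integrableOn_exp_mul_Ioi (by linarith) 0).const_mul _
  have hf : MeasureTheory.IntegrableOn (fun p => Real.exp (-s * ψ p)) (Set.Ioi (0:ℝ)) := by
    refine MeasureTheory.Integrable.mono' hexp (by fun_prop) ?_
    filter_upwards [MeasureTheory.ae_restrict_mem measurableSet_Ioi] with p hp
    rw [Real.norm_eq_abs, Real.abs_exp]
    exact hE p hp
  have hlim : Filter.Tendsto (fun p => Real.exp (-s * ψ p)) Filter.atTop (nhds 0) := by
    have h0 : Filter.Tendsto (fun p => Real.exp d * Real.exp (-(d / M) * p))
        Filter.atTop (nhds 0) := by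
      have : Filter.Tendsto (fun p : ℝ => -(d / M) * p) Filter.atTop Filter.atBot :=
        Filter.tendsto_id.const_mul_atTop_of_neg (by linarith)
      simpa using (Real.tendsto_exp_atBot.comp this).const_mul (Real.exp d)
    refine squeeze_zero' (Filter.Eventually.of_forall fun p => (Real.exp_pos _).le) ?_ h0
    filter_upwards [Filter.eventually_gt_atTop (0:ℝ)] with p hp
    exact hE p hp
  set I := ∫ p in Set.Ioi (0:ℝ), Real.cos (p * x) * Real.exp (-s * ψ p) with hI
  have hx2 : x ^ 2 * |I| ≤ A :=
    aux_ibp ψ hnonneg hdiff1 hdiff2 D₁ hD₁ hD1 s x hs hs1 hmeas hf hlim H hH hH0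
      (hHb s hs hs1) B hBd
  have hI0 : |I| ≤ K1 * m := by
    calc |I| ≤ ∫ p in Set.Ioi (0:ℝ), Real.exp d * Real.exp (-(d / M) * p) := by
          rw [← Real.norm_eq_abs]
          refine MeasureTheory.norm_integral_le_of_norm_le hexp ?_
          filter_upwards [MeasureTheory.ae_restrict_mem measurableSet_Ioi] with p hp
          rw [Real.norm_eq_abs, abs_mul, Real.abs_exp]
          exact (mul_le_of_le_one_left (Real.exp_pos _).le (Real.abs_cos_le_one _)).trans (hE p hp)
      _ = Real.exp d * (M / d) := by
          rw [MeasureTheory.integral_const_mul, integral_exp_mul_Ioi (by linarith)]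
          simp
      _ ≤ Real.exp d * (2 * K * m / d) := by gcongr
      _ = K1 * m := by rw [hK1]; ring
  have hπ : 0 < 1 / Real.pi := by positivity
  rw [le_div_iff₀ (by positivity)]
  unfold pdens
  rw [← hI]
  have hfin : (1 + x ^ 2) * I ≤ (K1 + A) * m := by
    have h1 : (1 + x ^ 2) * I ≤ (1 + x ^ 2) * |I| := by gcongr; exact le_abs_self _
    nlinarith
  calc 1 / Real.pi * I * (1 + x ^ 2) = 1 / Real.pi * ((1 + x ^ 2) * I) := by ring
    _ ≤ 1 / Real.pi * ((K1 + A) * m) := by gcongr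
    _ = _ := by ring
end

section
/- There exist a constant C < ∞ and h₀ ∈ (0,1) such that for all 0 < h ≤ h₀, ∫_ℝ v(x) dx ≤ C·h·log(1/h). -/
noncomputable def vfun (ψ : ℝ → ℝ) (h x : ℝ) : ℝ :=
  ∫ s in (0:ℝ)..1, |pdens ψ s (x + h) - pdens ψ s x|

open MeasureTheory FourierTransform SchwartzMap
open scoped ENNReal ContDiff

lemma fourier_cont (f : ℝ → ℂ) (h1 : Integrable f) : Continuous (𝓕 f : ℝ → ℂ) :=
    VectorFourier.fourierIntegral_continuous Real.continuous_fourierChar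
      (by exact continuous_inner) h1

lemma fourier_ae_eq_Lp (f : ℝ → ℂ) (h1 : Integrable f) (h2 : MemLp f 2) :
    (𝓕 f : ℝ → ℂ) =ᵐ[volume] ((𝓕 (h2.toLp f) : Lp ℂ 2 (volume : Measure ℝ)) : ℝ → ℂ) := by
  have hc := fourier_cont f h1
  apply ae_eq_of_integral_contDiff_smul_eq hc.locallyIntegrable
    ((Lp.memLp _).locallyIntegrable (by norm_num))
  intro g hg hgc
  have hgc' : HasCompactSupport (fun x => (g x : ℂ)) := hgc.comp_left (g := fun x : ℝ => (x:ℂ)) (by simp)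
  set G : 𝓢(ℝ, ℂ) := hgc'.toSchwartzMap (Complex.ofRealCLM.contDiff.comp hg) with hG
  have e := congrArg (fun T => T G) (Lp.fourier_toTemperedDistribution_eq (h2.toLp f))
  simp only [TemperedDistribution.fourier_apply, Lp.toTemperedDistribution_apply] at e
  have hGg : ∀ x, G x = (g x : ℂ) := fun x => rfl
  simp only [hGg] at e
  have e2 : ∫ x, g x • ((𝓕 (h2.toLp f) : Lp ℂ 2 (volume : Measure ℝ)) : ℝ → ℂ) x = ∫ x, (g x : ℂ) • ((𝓕 (h2.toLp f) : Lp ℂ 2 (volume : Measure ℝ)) : ℝ → ℂ) x := by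
    simp
  rw [e2, ← e]
  have e3 := VectorFourier.integral_fourierIntegral_smul_eq_flip (μ := volume) (ν := volume) (L := innerₗ ℝ)
    (f := (fun x => G x)) (g := f) Real.continuous_fourierChar (by exact continuous_inner) G.integrable h1
  have e4 : ∫ x, (𝓕 G) x • (h2.toLp f) x = ∫ x, (𝓕 G) x • f x := by
    apply integral_congr_ae
    filter_upwards [h2.coeFn_toLp] with x hx
    rw [hx]
  rw [e4]
  have e5 : ∫ x, g x • 𝓕 f x = ∫ x, G x • 𝓕 f x := by
    simp [hGg]
  rw [e5, SchwartzMap.fourier_coe]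
  rw [flip_innerₗ] at e3
  exact e3.symm

lemma plancherel_two (f : ℝ → ℂ) (h1 : Integrable f) (h2 : MemLp f 2) :
    ∫⁻ x, ‖𝓕 f x‖ₑ ^ 2 = ∫⁻ x, ‖f x‖ₑ ^ 2 := by
  have h := Lp.norm_fourier_eq (h2.toLp f)
  rw [Lp.norm_def, Lp.norm_def, ENNReal.toReal_eq_toReal_iff' (Lp.eLpNorm_ne_top _) (Lp.eLpNorm_ne_top _),
    ← eLpNorm_congr_ae (fourier_ae_eq_Lp f h1 h2), eLpNorm_congr_ae h2.coeFn_toLp] at h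
  have key : ∀ u : ℝ → ℂ, ∫⁻ x, ‖u x‖ₑ ^ 2 = (eLpNorm u 2 volume) ^ (2:ℝ) := by
    intro u
    have := eLpNorm_nnreal_pow_eq_lintegral (μ := volume) (f := u) (p := 2) (by norm_num)
    simpa using this.symm
  rw [key, key, h]

lemma lint_cauchy (a : ℝ) (ha : 0 < a) :
    ∫⁻ y : ℝ, ENNReal.ofReal ((a^2 + y^2)⁻¹) = ENNReal.ofReal (Real.pi / a) := by
  have e : (fun y : ℝ => (a^2 + y^2)⁻¹) = fun y => (a^2)⁻¹ * (1 + (y / a)^2)⁻¹ := by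
    ext y
    have : a^2 + y^2 ≠ 0 := by positivity
    have : 1 + (y/a)^2 ≠ 0 := by positivity
    field_simp
  have hi : Integrable (fun y : ℝ => (a^2 + y^2)⁻¹) := by
    rw [e]
    exact (integrable_inv_one_add_sq.comp_div ha.ne').const_mul _
  rw [← ofReal_integral_eq_lintegral_ofReal hi (Filter.Eventually.of_forall fun y => by positivity), e,
    integral_const_mul, Measure.integral_comp_div (fun y => (1 + y^2)⁻¹) a, integral_univ_inv_one_add_sq,
    abs_of_pos ha]
  congr 1
  simp only [smul_eq_mul]
  field_simp

lemma L1_bound (f : ℝ → ℂ) (h1 : Integrable f) (h2 : MemLp f 2) (hd : Differentiable ℝ f)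
    (h1' : Integrable (deriv f)) (h2' : MemLp (deriv f) 2) (A B a ε : ℝ) (hA0 : 0 ≤ A) (hB0 : 0 ≤ B)
    (ha : 0 < a) (hε : 0 < ε)
    (hA : ∫⁻ x, ‖f x‖ₑ ^ 2 ≤ ENNReal.ofReal A) (hB : ∫⁻ x, ‖deriv f x‖ₑ ^ 2 ≤ ENNReal.ofReal B) :
    ∫⁻ y, ‖𝓕 f y‖ₑ ≤ ENNReal.ofReal (ε * (Real.pi / a) + (a^2 * A + B) / ε) := by
  have hder := Real.fourier_deriv h1 hd h1'
  rw [← plancherel_two f h1 h2] at hA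
  rw [← plancherel_two _ h1' h2'] at hB
  have hc := (fourier_cont f h1)
  have hc' := (fourier_cont _ h1')
  have en : ∀ z : ℂ, ‖z‖ₑ = ENNReal.ofReal ‖z‖ := fun z => (ofReal_norm z).symm
  have pt : ∀ y : ℝ, ‖𝓕 f y‖ₑ ≤ ENNReal.ofReal ε * ENNReal.ofReal ((a^2 + y^2)⁻¹) +
      (ENNReal.ofReal (a^2/ε) * ‖𝓕 f y‖ₑ^2 + ENNReal.ofReal (1/ε) * ‖𝓕 (deriv f) y‖ₑ^2) := by
    intro y
    have h3 : ‖𝓕 (deriv f) y‖ = 2 * Real.pi * |y| * ‖𝓕 f y‖ := by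
      rw [hder]
      simp [abs_of_pos Real.pi_pos]
    rw [en, en, h3, ← ENNReal.ofReal_pow (by positivity), ← ENNReal.ofReal_pow (by positivity),
      ← ENNReal.ofReal_mul (by positivity), ← ENNReal.ofReal_mul (by positivity),
      ← ENNReal.ofReal_mul (by positivity), ← ENNReal.ofReal_add (by positivity) (by positivity),
      ← ENNReal.ofReal_add (by positivity) (by positivity)]
    apply ENNReal.ofReal_le_ofReal
    set F := ‖𝓕 f y‖
    have hF : 0 ≤ F := norm_nonneg _
    set w := a^2 + y^2 with hw
    have hwp : 0 < w := by positivity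
    have k1 : F ≤ ε * w⁻¹ + w * F^2 / ε := by
      have : ε * w⁻¹ + w * F^2 / ε - F = ((ε - w * F / 2)^2 + 3/4 * (w * F)^2) / (ε * w) := by
        field_simp; ring
      have : 0 ≤ ((ε - w * F / 2)^2 + 3/4 * (w * F)^2) / (ε * w) := by positivity
      linarith
    have k2 : w * F^2 / ε ≤ a^2/ε * F^2 + 1/ε * (2 * Real.pi * |y| * F)^2 := by
      have : a^2/ε * F^2 + 1/ε * (2 * Real.pi * |y| * F)^2 = (a^2 * F^2 + (2*Real.pi)^2 * (y^2 * F^2))/ε := by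
        rw [mul_pow, mul_pow, sq_abs]; field_simp
      rw [this]
      gcongr
      have h6 : 1 ≤ (2 * Real.pi)^2 := by nlinarith [Real.pi_gt_three]
      nlinarith [mul_nonneg (sub_nonneg.2 h6) (show 0 ≤ y^2 * F^2 by positivity)]
    linarith
  refine (lintegral_mono pt).trans ?_
  rw [lintegral_add_left (by fun_prop), lintegral_const_mul' _ _ (by simp), lint_cauchy a ha,
    lintegral_add_left (by fun_prop), lintegral_const_mul' _ _ (by simp), lintegral_const_mul' _ _ (by simp),
    add_div, ENNReal.ofReal_add (by positivity) (by positivity), ENNReal.ofReal_mul (by positivity),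
    ENNReal.ofReal_add (by positivity) (by positivity),
    show a^2 * A / ε = a^2 / ε * A by ring, show B / ε = 1 / ε * B by ring,
    ENNReal.ofReal_mul (by positivity), ENNReal.ofReal_mul (p := 1/ε) (by positivity)]
  gcongr

lemma int_pow_exp (α b q : ℝ) (hα : 0 < α) (hb : 0 < b) (hq : 0 ≤ q) :
    Integrable (fun p : ℝ => |p| ^ q * Real.exp (-b * |p| ^ α)) ∧
    ∫ p : ℝ, |p| ^ q * Real.exp (-b * |p| ^ α) =
      b ^ (-(q+1)/α) * (2 * ((1 / α) * Real.Gamma ((q+1)/α))) := by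
  have e := integral_rpow_mul_exp_neg_mul_rpow hα (by linarith : -1 < q) hb
  have e2 := integral_comp_abs (f := fun p : ℝ => p ^ q * Real.exp (-b * p ^ α))
  have hG : 0 < Real.Gamma ((q+1)/α) := Real.Gamma_pos_of_pos (by positivity)
  have e3 : ∫ p : ℝ, |p| ^ q * Real.exp (-b * |p| ^ α) =
      b ^ (-(q+1)/α) * (2 * ((1 / α) * Real.Gamma ((q+1)/α))) := by
    rw [e2, e]; ring
  refine ⟨?_, e3⟩
  by_contra hcon
  rw [integral_undef hcon] at e3
  have : 0 < b ^ (-(q+1)/α) * (2 * ((1 / α) * Real.Gamma ((q+1)/α))) := by positivity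
  linarith

lemma sq_bound (f : ℝ → ℂ) (hm : Measurable f) (α : ℝ) (q : ℝ) (hq : 0 ≤ q) (hα : 0 < α) (b H : ℝ) (hb : 0 < b) (hH : 0 < H)
    (hf : ∀ p, ‖f p‖ ≤ H * (|p| ^ q * Real.exp (-b * |p| ^ α))) :
    Integrable f ∧ MemLp f 2 ∧ ∫⁻ x, ‖f x‖ₑ ^ 2 ≤
      ENNReal.ofReal (H^2 * ((2*b) ^ (-(2*q+1)/α) * (2 * ((1 / α) * Real.Gamma ((2*q+1)/α))))) := by
  have i1 := (int_pow_exp α b q hα hb hq).1.const_mul H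
  obtain ⟨i2, e2⟩ := int_pow_exp α (2*b) (2*q) hα (by positivity) (by positivity)
  have hsq : ∀ p, ‖f p‖^2 ≤ H^2 * (|p| ^ (2*q) * Real.exp (-(2*b) * |p| ^ α)) := by
    intro p
    refine (pow_le_pow_left₀ (norm_nonneg _) (hf p) 2).trans (le_of_eq ?_)
    rw [mul_pow, mul_pow, ← Real.exp_nat_mul, mul_comm 2 q, Real.rpow_mul (abs_nonneg p)]
    norm_num
    left; left; ring_nf
  refine ⟨i1.mono' hm.aestronglyMeasurable (.of_forall hf), ?_, ?_⟩
  · rw [memLp_two_iff_integrable_sq_norm hm.aestronglyMeasurable]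
    refine (i2.const_mul (H^2)).mono' (by fun_prop) (.of_forall fun p => ?_)
    rw [Real.norm_of_nonneg (by positivity)]
    exact hsq p
  · rw [← e2, ← integral_const_mul, ofReal_integral_eq_lintegral_ofReal (i2.const_mul (H^2))
      (.of_forall fun p => by positivity)]
    refine lintegral_mono fun p => ?_
    rw [← ofReal_norm, ← ENNReal.ofReal_pow (by positivity)]
    exact ENNReal.ofReal_le_ofReal (hsq p)

lemma L1_scaled (α : ℝ) (hα : 0 < α) : ∃ C : ℝ, 0 ≤ C ∧ ∀ (f : ℝ → ℂ) (b H : ℝ), 0 < b → 0 < H →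
    Differentiable ℝ f → (∀ p, ‖f p‖ ≤ H * (|p| * Real.exp (-b * |p| ^ α))) →
    (∀ p, ‖deriv f p‖ ≤ H * Real.exp (-b * |p| ^ α)) →
    ∫⁻ y, ‖𝓕 f y‖ₑ ≤ ENNReal.ofReal (C * H * b ^ (-1/α)) := by
  have g1 : 0 < Real.Gamma (1/α) := Real.Gamma_pos_of_pos (by positivity)
  have g3 : 0 < Real.Gamma (3/α) := Real.Gamma_pos_of_pos (by positivity)
  refine ⟨Real.pi + (2:ℝ)^(-3/α) * (2 * ((1 / α) * Real.Gamma (3/α))) +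
     (2:ℝ)^(-1/α) * (2 * ((1 / α) * Real.Gamma (1/α))), by positivity, ?_⟩
  intro f b H hb hH hd hf hf'
  obtain ⟨a1, a2, a3⟩ := sq_bound f hd.continuous.measurable α 1 (by norm_num) hα b H hb hH (by simpa using hf)
  obtain ⟨b1, b2, b3⟩ := sq_bound (deriv f) (measurable_deriv f) α 0 (by norm_num) hα b H hb hH (by simpa using hf')
  have := L1_bound f a1 a2 hd b1 b2 _ _ (b^(1/α)) H (by norm_num; positivity) (by norm_num; positivity)
    (by positivity) hH a3 b3
  refine this.trans (le_of_eq ?_)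
  congr 1
  norm_num only
  rw [Real.mul_rpow (by norm_num) hb.le, Real.mul_rpow (by norm_num) hb.le]
  have r1 : b ^ (-1/α) = (b^(1/α))⁻¹ := by rw [← Real.rpow_neg hb.le]; ring_nf
  have r3 : b ^ (-3/α) = (b^(1/α))⁻¹^3 := by 
    rw [← r1, ← Real.rpow_natCast, ← Real.rpow_mul hb.le]; ring_nf
  have hp : 0 < b^(1/α) := by positivity
  rw [r1, r3]
  field_simp
  try ring

lemma psi_lower (β : ℝ) (hβ1 : 1 < β) (ψ : ℝ → ℝ)
    (heven : ∀ p : ℝ, ψ (-p) = ψ p)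
    (hnonneg : ∀ p : ℝ, 0 ≤ ψ p)
    (hpos : ∀ p : ℝ, p ≠ 0 → 0 < ψ p)
    (hRV : ∀ l : ℝ, 0 < l →
      Filter.Tendsto (fun x => ψ (l * x) / ψ x) Filter.atTop (nhds (l ^ β)))
    (hdiff1 : ∀ p : ℝ, 0 < p → DifferentiableAt ℝ ψ p) :
    ∃ α c : ℝ, 1 < α ∧ 0 < c ∧ ∀ p, c * |p| ^ α - c ≤ ψ p := by
  obtain ⟨α, h1α, hαβ⟩ := exists_between hβ1
  have hlt : (2:ℝ)^α < 2^β := Real.rpow_lt_rpow_of_exponent_lt (by norm_num) hαβ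
  have ev := (hRV 2 (by norm_num)).eventually (lt_mem_nhds hlt)
  obtain ⟨X0, hX0⟩ := Filter.eventually_atTop.1 ev
  set X := max X0 1 with hX
  have hX1 : 1 ≤ X := le_max_right _ _
  have hdbl : ∀ x, X ≤ x → 2^α * ψ x ≤ ψ (2 * x) := by
    intro x hx
    have := hX0 x ((le_max_left _ _).trans hx)
    have hp := hpos x (by linarith)
    exact ((lt_div_iff₀ hp).1 this).le
  have hcont : ContinuousOn ψ (Set.Icc 1 (2*X)) := fun p hp =>
    (hdiff1 p (by linarith [hp.1])).continuousAt.continuousWithinAt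
  obtain ⟨x₀, hx₀, hmin⟩ := isCompact_Icc.exists_isMinOn (Set.nonempty_Icc.2 (by linarith : (1:ℝ) ≤ 2*X)) hcont
  set m := ψ x₀
  have hm : 0 < m := hpos x₀ (by linarith [hx₀.1])
  have hmin' : ∀ p, 1 ≤ p → p ≤ 2*X → m ≤ ψ p := fun p h1 h2 => hmin ⟨h1, h2⟩
  have h2X : 0 < (2*X)^α := by positivity
  set c := m / (2*X)^α with hc
  have hcp : 0 < c := by positivity
  have hind : ∀ n : ℕ, ∀ p, 1 ≤ p → p ≤ 2^n * (2*X) → c * p^α ≤ ψ p := by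
    intro n
    induction n with
    | zero =>
      intro p h1 h2
      rw [pow_zero, one_mul] at h2
      refine le_trans ?_ (hmin' p h1 h2)
      rw [hc, div_mul_eq_mul_div, div_le_iff₀ h2X]
      gcongr
    | succ n ih =>
      intro p h1 h2
      by_cases hp : p ≤ 2*X
      · refine ih p h1 (hp.trans ?_)
        have : (1:ℝ) ≤ 2^n := one_le_pow₀ (by norm_num)
        nlinarith
      · push Not at hp
        have k1 := ih (p/2) (by linarith) (by rw [pow_succ] at h2; linarith)
        have k2 := hdbl (p/2) (by linarith)
        rw [show 2 * (p/2) = p by ring] at k2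
        refine le_trans ?_ k2
        have : p^α = 2^α * (p/2)^α := by
          rw [← Real.mul_rpow (by norm_num) (by linarith)]; congr 1; ring
        rw [this]
        have h2α : 0 < (2:ℝ)^α := by positivity
        nlinarith [mul_le_mul_of_nonneg_left k1 h2α.le]
  have hge : ∀ p, 1 ≤ p → c * p^α ≤ ψ p := by
    intro p hp
    obtain ⟨n, hn⟩ := pow_unbounded_of_one_lt p (by norm_num : (1:ℝ) < 2)
    refine hind n p hp ?_
    have : (0:ℝ) < 2^n := by positivity
    nlinarith
  refine ⟨α, c, h1α, hcp, fun p => ?_⟩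
  have habs : ψ |p| = ψ p := by
    rcases abs_choice p with h | h <;> rw [h]; exact heven p
  rcases le_total 1 |p| with h | h
  · have := hge |p| h
    rw [habs] at this
    linarith
  · have : |p|^α ≤ 1 := Real.rpow_le_one (abs_nonneg p) h (by linarith)
    nlinarith [hnonneg p]

lemma psi_deriv_zero (ψ : ℝ → ℝ) (hnonneg : ∀ p : ℝ, 0 ≤ ψ p)
    (C₀ : ℝ) (hC0 : ∀ p : ℝ, ψ p ≤ C₀ * p ^ 2) : HasDerivAt ψ 0 0 := by
  have h0 : ψ 0 = 0 := le_antisymm (by simpa using hC0 0) (hnonneg 0)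
  have hO : ψ =O[nhds 0] fun p => p^2 := by
    refine Asymptotics.IsBigO.of_bound C₀ (.of_forall fun p => ?_)
    rw [Real.norm_of_nonneg (hnonneg p), Real.norm_of_nonneg (by positivity)]
    exact hC0 p
  have ho : (fun p : ℝ => p^2) =o[nhds 0] fun p => p := by
    simpa using Asymptotics.isLittleO_pow_pow (𝕜 := ℝ) (m := 1) (n := 2) (by norm_num)
  rw [hasDerivAt_iff_isLittleO]
  simpa [h0] using hO.trans_isLittleO ho

lemma psi_deriv_bdd (ψ : ℝ → ℝ)
    (hdiff2 : ∀ p : ℝ, 0 < p → DifferentiableAt ℝ (deriv ψ) p)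
    (hint2 : MeasureTheory.IntegrableOn (fun l : ℝ => |deriv (deriv ψ) l|) (Set.Ioc (0:ℝ) 1)) :
    ∃ M : ℝ, 0 ≤ M ∧ ∀ p, 0 < p → p ≤ 1 → |deriv ψ p| ≤ M := by
  refine ⟨|deriv ψ 1| + ∫ l in Set.Ioc (0:ℝ) 1, |deriv (deriv ψ) l|, ?_, ?_⟩
  · have := integral_nonneg (μ := volume.restrict (Set.Ioc (0:ℝ) 1)) (f := fun l => |deriv (deriv ψ) l|) (fun l => abs_nonneg _)
    positivity
  intro p hp0 hp1
  have hint : IntegrableOn (deriv (deriv ψ)) (Set.Ioc 0 1) := by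
    refine hint2.mono' (measurable_deriv _).aestronglyMeasurable (.of_forall fun l => le_rfl)
  have hsub : Set.Ioc p 1 ⊆ Set.Ioc 0 1 := Set.Ioc_subset_Ioc_left hp0.le
  have hii : IntervalIntegrable (deriv (deriv ψ)) volume p 1 := by
    rw [intervalIntegrable_iff_integrableOn_Ioc_of_le hp1]
    exact hint.mono_set hsub
  have ftc := intervalIntegral.integral_eq_sub_of_hasDerivAt (f := deriv ψ) (f' := deriv (deriv ψ)) (a := p) (b := 1)
    (fun x hx => by
      rw [Set.uIcc_of_le hp1] at hx
      exact (hdiff2 x (by linarith [hx.1])).hasDerivAt) hii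
  have b1 : |∫ l in p..1, deriv (deriv ψ) l| ≤ ∫ l in Set.Ioc (0:ℝ) 1, |deriv (deriv ψ) l| := by
    refine (intervalIntegral.abs_integral_le_integral_abs hp1).trans ?_
    rw [intervalIntegral.integral_of_le hp1]
    exact setIntegral_mono_set hint2 (.of_forall fun l => abs_nonneg _) hsub.eventuallyLE
  rw [ftc] at b1
  have := abs_sub_abs_le_abs_sub (deriv ψ p) (deriv ψ 1)
  rw [abs_sub_comm] at this
  linarith

lemma psi_weight (ψ : ℝ → ℝ)
    (heven : ∀ p : ℝ, ψ (-p) = ψ p)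
    (hnonneg : ∀ p : ℝ, 0 ≤ ψ p)
    (hdiff2 : ∀ p : ℝ, 0 < p → DifferentiableAt ℝ (deriv ψ) p)
    (D₁ : ℝ)
    (hD1 : ∀ l : ℝ, 1 ≤ l → l * |deriv ψ l| ≤ D₁ * ψ l)
    (hint2 : MeasureTheory.IntegrableOn (fun l : ℝ => |deriv (deriv ψ) l|) (Set.Ioc (0:ℝ) 1))
    (C₀ : ℝ) (hC0 : ∀ p : ℝ, ψ p ≤ C₀ * p ^ 2)
    (α c : ℝ) (hc : 0 < c) (hlow : ∀ p, c * |p| ^ α - c ≤ ψ p) :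
    ∃ K : ℝ, 0 < K ∧ ∀ s, 0 < s → s ≤ 1 → ∀ p,
      (1 + s * (|p| * |deriv ψ p|)) * Real.exp (-s * ψ p) ≤ K * Real.exp (-(s * (c/2)) * |p| ^ α) := by
  obtain ⟨M, hM0, hM⟩ := psi_deriv_bdd ψ hdiff2 hint2
  have hd0 : deriv ψ 0 = 0 := (psi_deriv_zero ψ hnonneg C₀ hC0).deriv
  have hodd : ∀ p, abs (deriv ψ (abs p)) = |deriv ψ p| := by
    intro p
    rcases abs_choice p with h | h <;> rw [h]
    have : deriv (fun x => ψ (-x)) p = - deriv ψ (-p) := deriv_comp_neg ψ p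
    rw [funext heven] at this
    rw [this, abs_neg]
  have habs : ∀ p, ψ |p| = ψ p := by
    intro p
    rcases abs_choice p with h | h <;> rw [h]; exact heven p
  have hall : ∀ p, |p| * |deriv ψ p| ≤ M + |D₁| * ψ p := by
    intro p
    have hDp : 0 ≤ |D₁| * ψ p := mul_nonneg (abs_nonneg _) (hnonneg p)
    rcases le_total 1 |p| with h | h
    · have := hD1 |p| h
      rw [hodd, habs] at this
      have h2 := mul_le_mul_of_nonneg_right (le_abs_self D₁) (hnonneg p)
      linarith
    · rcases eq_or_ne p 0 with rfl | h0
      · simp [hd0]; linarith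
      · have := hM |p| (abs_pos.2 h0) h
        rw [hodd] at this
        have := mul_le_mul h this (abs_nonneg _) zero_le_one
        linarith
  refine ⟨(1 + M + 2 * |D₁|) * Real.exp (c/2), by positivity, fun s hs hs1 p => ?_⟩
  have k1 : 1 + s * (|p| * |deriv ψ p|) ≤ (1 + M + 2 * |D₁|) * Real.exp (s * ψ p / 2) := by
    have e1 : 1 ≤ Real.exp (s * ψ p / 2) := Real.one_le_exp (by have := hnonneg p; positivity)
    have e2 : s * ψ p / 2 ≤ Real.exp (s * ψ p / 2) := by linarith [Real.add_one_le_exp (s * ψ p / 2)]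
    have e3 := mul_le_mul_of_nonneg_left (hall p) hs.le
    have e4 := mul_le_mul_of_nonneg_left e2 (abs_nonneg D₁)
    nlinarith [mul_le_mul_of_nonneg_left e1 hM0]
  calc _ ≤ (1 + M + 2 * |D₁|) * Real.exp (s * ψ p / 2) * Real.exp (-s * ψ p) := by gcongr
    _ = (1 + M + 2 * |D₁|) * Real.exp (-(s/2 * ψ p)) := by
      rw [mul_assoc, ← Real.exp_add]; ring_nf
    _ ≤ (1 + M + 2 * |D₁|) * (Real.exp (c/2 + -(s * (c/2)) * |p| ^ α)) := by
      gcongr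
      nlinarith [mul_le_mul_of_nonneg_left (hlow p) hs.le]
    _ = _ := by rw [Real.exp_add, mul_assoc]
/-- The symbol whose Fourier transform is the increment of the density. -/
noncomputable def Gsym (ψ : ℝ → ℝ) (h s p : ℝ) : ℂ :=
  (Complex.exp (((-(h * p) : ℝ) : ℂ) * Complex.I) - 1) * ((Real.exp (-s * ψ p) : ℝ) : ℂ)

lemma exp_sub_one_norm (t : ℝ) : ‖Complex.exp ((t : ℂ) * Complex.I) - 1‖ ≤ |t| := by
  rw [mul_comm]
  exact Real.norm_exp_I_mul_ofReal_sub_one_le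

lemma Gsym_hasDeriv (ψ : ℝ → ℝ) (hdiff : Differentiable ℝ ψ) (h s p : ℝ) :
    HasDerivAt (Gsym ψ h s) (
      (Complex.exp (((-(h * p) : ℝ) : ℂ) * Complex.I) * (((-h : ℝ) : ℂ) * Complex.I)) *
        ((Real.exp (-s * ψ p) : ℝ) : ℂ) +
      (Complex.exp (((-(h * p) : ℝ) : ℂ) * Complex.I) - 1) *
        ((Real.exp (-s * ψ p) * (-s * deriv ψ p) : ℝ) : ℂ)) p := by
  have d1 : HasDerivAt (fun p : ℝ => -(h * p)) (-h) p := by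
    have := (hasDerivAt_id p).const_mul (-h)
    simpa using this
  have d2 := ((d1.ofReal_comp.mul_const Complex.I).cexp).sub_const 1
  have d3 := (((hdiff p).hasDerivAt.const_mul (-s)).exp).ofReal_comp
  exact d2.mul d3

lemma Gsym_bounds (ψ : ℝ → ℝ) (hdiff : Differentiable ℝ ψ) (h s K b α : ℝ) (hh : 0 < h) (hs : 0 < s)
    (hK : ∀ p, (1 + s * (|p| * |deriv ψ p|)) * Real.exp (-s * ψ p) ≤ K * Real.exp (-b * |p| ^ α)) (p : ℝ) :
    ‖Gsym ψ h s p‖ ≤ (h * K) * (|p| * Real.exp (-b * |p| ^ α)) ∧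
    ‖deriv (Gsym ψ h s) p‖ ≤ (h * K) * Real.exp (-b * |p| ^ α) := by
  have e1 := exp_sub_one_norm (-(h*p))
  rw [abs_neg, abs_mul, abs_of_pos hh] at e1
  have hE := Real.exp_pos (-s * ψ p)
  have hKp := hK p
  constructor
  · rw [Gsym, norm_mul, Complex.norm_real, Real.norm_of_nonneg hE.le]
    calc _ ≤ h * |p| * Real.exp (-s * ψ p) := by gcongr
      _ ≤ h * |p| * (K * Real.exp (-b * |p| ^ α)) := by
        gcongr
        refine le_trans ?_ hKp
        have : 0 ≤ s * (|p| * |deriv ψ p|) := by positivity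
        nlinarith
      _ = _ := by ring
  · rw [(Gsym_hasDeriv ψ hdiff h s p).deriv]
    refine (norm_add_le _ _).trans ?_
    rw [norm_mul, norm_mul, norm_mul, norm_mul, Complex.norm_real, Complex.norm_real, Complex.norm_real,
      Complex.norm_exp_ofReal_mul_I, Complex.norm_I, norm_mul, norm_mul, Real.norm_of_nonneg hE.le,
      norm_neg, norm_neg, Real.norm_of_nonneg hh.le, Real.norm_of_nonneg hs.le, Real.norm_eq_abs]
    calc _ ≤ 1 * (h * 1) * Real.exp (-s * ψ p) + h * |p| * (Real.exp (-s * ψ p) * (s * |deriv ψ p|)) := by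
          gcongr
      _ = h * ((1 + s * (|p| * |deriv ψ p|)) * Real.exp (-s * ψ p)) := by ring
      _ ≤ h * (K * Real.exp (-b * |p| ^ α)) := by gcongr
      _ = _ := by ring

lemma pdens_full (ψ : ℝ → ℝ) (heven : ∀ p : ℝ, ψ (-p) = ψ p) (s x : ℝ) :
    pdens ψ s x = (1 / (2 * Real.pi)) * ∫ p : ℝ, Real.cos (p * x) * Real.exp (-s * ψ p) := by
  have e := integral_comp_abs (f := fun p => Real.cos (p * x) * Real.exp (-s * ψ p))
  have e2 : (fun p : ℝ => Real.cos (|p| * x) * Real.exp (-s * ψ |p|)) =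
      fun p => Real.cos (p * x) * Real.exp (-s * ψ p) := by
    ext p
    rcases abs_choice p with h | h <;> rw [h]
    rw [heven, neg_mul, Real.cos_neg]
  rw [e2] at e
  rw [pdens, e, ← mul_assoc]
  congr 1
  have := Real.pi_pos
  field_simp

lemma diff_le_fourier (ψ : ℝ → ℝ) (heven : ∀ p : ℝ, ψ (-p) = ψ p) (h s y : ℝ)
    (hE : Integrable (fun p => Real.exp (-s * ψ p))) (hG : Integrable (Gsym ψ h s)) :
    |pdens ψ s (2 * Real.pi * y + h) - pdens ψ s (2 * Real.pi * y)| ≤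
      (1 / (2 * Real.pi)) * ‖𝓕 (Gsym ψ h s) y‖ := by
  have hcos : ∀ x : ℝ, Integrable (fun p : ℝ => Real.cos (p * x) * Real.exp (-s * ψ p)) := by
    intro x
    refine hE.mono (by
      exact (by fun_prop : Continuous fun p : ℝ => Real.cos (p * x)).aestronglyMeasurable.mul hE.aestronglyMeasurable)
      (.of_forall fun p => ?_)
    rw [norm_mul]
    exact mul_le_of_le_one_left (norm_nonneg _) (Real.abs_cos_le_one _)
  rw [pdens_full ψ heven, pdens_full ψ heven, ← mul_sub, ← integral_sub (hcos _) (hcos _), abs_mul,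
    abs_of_pos (by positivity)]
  gcongr
  have hre : (𝓕 (Gsym ψ h s) y).re = ∫ p : ℝ, (Real.cos (p * (2 * Real.pi * y + h)) * Real.exp (-s * ψ p) -
      Real.cos (p * (2 * Real.pi * y)) * Real.exp (-s * ψ p)) := by
    rw [Real.fourier_eq']
    have hi : Integrable (fun v : ℝ => Complex.exp (↑(-2 * Real.pi * inner ℝ v y) * Complex.I) • Gsym ψ h s v) := by
      refine hG.mono (by
        exact (by fun_prop : Continuous fun v : ℝ => Complex.exp (↑(-2 * Real.pi * inner ℝ v y) * Complex.I)).aestronglyMeasurable.smul hG.aestronglyMeasurable) (.of_forall fun p => ?_)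
      rw [norm_smul, Complex.norm_exp_ofReal_mul_I, one_mul]
    have := integral_re hi
    simp only [RCLike.re_to_complex] at this
    rw [← this]
    congr 1
    ext p
    rw [Gsym, smul_eq_mul, ← mul_assoc, mul_sub, ← Complex.exp_add, ← add_mul, ← Complex.ofReal_add, mul_one,
      Complex.re_mul_ofReal, Complex.sub_re, Complex.exp_ofReal_mul_I_re, Complex.exp_ofReal_mul_I_re, sub_mul]
    rw [← Real.cos_neg (p * (2 * Real.pi * y + h)), ← Real.cos_neg (p * (2 * Real.pi * y))]
    simp only [inner]
    congr 4 <;> simp <;> ring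
  rw [← hre]
  exact Complex.abs_re_le_norm _

lemma lintegral_dilate (c : ℝ) (hc : 0 < c) (φ : ℝ → ℝ≥0∞) :
    ∫⁻ x, φ x = ENNReal.ofReal c * ∫⁻ y, φ (c * y) := by
  have h := Real.smul_map_volume_mul_left hc.ne'
  rw [abs_of_pos hc] at h
  conv_lhs => rw [← h]
  rw [lintegral_smul_measure, smul_eq_mul]
  congr 1
  exact (Homeomorph.mulLeft₀ c hc.ne').measurableEmbedding.lintegral_map φ

lemma pdens_meas (ψ : ℝ → ℝ) (hmeas : Measurable ψ) :
    Measurable (fun q : ℝ × ℝ => pdens ψ q.1 q.2) := by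
  unfold pdens
  refine Measurable.const_mul ?_ _
  have : StronglyMeasurable (fun r : (ℝ × ℝ) × ℝ => Real.cos (r.2 * r.1.2) * Real.exp (-r.1.1 * ψ r.2)) :=
    Measurable.stronglyMeasurable (by fun_prop)
  exact this.integral_prod_right'.measurable

lemma vfun_bound (ψ : ℝ → ℝ) (hmeas : Measurable ψ) (h A γ : ℝ) (hA : 0 ≤ A) (hγ : -1 < γ)
    (hb : ∀ s, 0 < s → s ≤ 1 → ∫⁻ x, ‖pdens ψ s (x + h) - pdens ψ s x‖ₑ ≤ ENNReal.ofReal (A * s ^ γ)) :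
    ∫ x, vfun ψ h x ≤ A * ∫ s in (0:ℝ)..1, s ^ γ := by
  have hi : IntegrableOn (fun s : ℝ => A * s ^ γ) (Set.Ioc 0 1) := by
    have := intervalIntegral.intervalIntegrable_rpow' (a := 0) (b := 1) hγ
    rw [intervalIntegrable_iff_integrableOn_Ioc_of_le zero_le_one] at this
    exact this.const_mul A
  have hm := pdens_meas ψ hmeas
  have hmm : Measurable (fun q : ℝ × ℝ => ‖pdens ψ q.2 (q.1 + h) - pdens ψ q.2 q.1‖ₑ) := by
    have m1 : Measurable (fun q : ℝ × ℝ => pdens ψ q.2 (q.1 + h)) :=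
      hm.comp (g := fun q : ℝ × ℝ => pdens ψ q.1 q.2) (f := fun q : ℝ × ℝ => (q.2, q.1 + h))
        (measurable_snd.prodMk (measurable_fst.add_const h))
    have m2 : Measurable (fun q : ℝ × ℝ => pdens ψ q.2 q.1) :=
      hm.comp (g := fun q : ℝ × ℝ => pdens ψ q.1 q.2) (f := fun q : ℝ × ℝ => (q.2, q.1))
        (measurable_snd.prodMk measurable_fst)
    exact (m1.sub m2).enorm
  have hJ : 0 ≤ A * ∫ s in (0:ℝ)..1, s ^ γ := by
    refine mul_nonneg hA (intervalIntegral.integral_nonneg zero_le_one fun s hs => ?_)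
    exact Real.rpow_nonneg hs.1 _
  have main : ‖∫ x, vfun ψ h x‖ₑ ≤ ENNReal.ofReal (A * ∫ s in (0:ℝ)..1, s ^ γ) := by
    calc ‖∫ x, vfun ψ h x‖ₑ ≤ ∫⁻ x, ‖vfun ψ h x‖ₑ := enorm_integral_le_lintegral_enorm _
      _ ≤ ∫⁻ x, ∫⁻ s in Set.Ioc (0:ℝ) 1, ‖pdens ψ s (x + h) - pdens ψ s x‖ₑ := by
        refine lintegral_mono fun x => ?_
        rw [vfun, intervalIntegral.integral_of_le zero_le_one]
        refine (enorm_integral_le_lintegral_enorm _).trans (le_of_eq ?_)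
        simp [Real.enorm_abs]
      _ = ∫⁻ s in Set.Ioc (0:ℝ) 1, ∫⁻ x, ‖pdens ψ s (x + h) - pdens ψ s x‖ₑ :=
        lintegral_lintegral_swap hmm.aemeasurable
      _ ≤ ∫⁻ s in Set.Ioc (0:ℝ) 1, ENNReal.ofReal (A * s ^ γ) := by
        refine setLIntegral_mono' measurableSet_Ioc fun s hs => hb s hs.1 hs.2
      _ = _ := by
        rw [← ofReal_integral_eq_lintegral_ofReal hi, integral_const_mul,
          intervalIntegral.integral_of_le zero_le_one]
        refine (ae_restrict_iff' measurableSet_Ioc).2 (.of_forall fun s hs => ?_)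
        exact mul_nonneg hA (Real.rpow_nonneg hs.1.le _)
  rw [← ofReal_norm, ENNReal.ofReal_le_ofReal_iff hJ] at main
  exact (le_abs_self _).trans main
theorem stmt_4
    (β : ℝ) (hβ1 : 1 < β) (hβ2 : β ≤ 2)
    (ψ : ℝ → ℝ)
    (hmeas : Measurable ψ)
    (heven : ∀ p : ℝ, ψ (-p) = ψ p)
    (hnonneg : ∀ p : ℝ, 0 ≤ ψ p)
    (hpos : ∀ p : ℝ, p ≠ 0 → 0 < ψ p)
    (hRV : ∀ l : ℝ, 0 < l →
      Filter.Tendsto (fun x => ψ (l * x) / ψ x) Filter.atTop (nhds (l ^ β)))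
    (hdiff1 : ∀ p : ℝ, 0 < p → DifferentiableAt ℝ ψ p)
    (hdiff2 : ∀ p : ℝ, 0 < p → DifferentiableAt ℝ (deriv ψ) p)
    (D₁ D₂ : ℝ)
    (hD1 : ∀ l : ℝ, 1 ≤ l → l * |deriv ψ l| ≤ D₁ * ψ l)
    (hD2 : ∀ l : ℝ, 1 ≤ l → l ^ 2 * |deriv (deriv ψ) l| ≤ D₂ * ψ l)
    (hint1 : MeasureTheory.IntegrableOn (fun l : ℝ => (deriv ψ l) ^ 2) (Set.Ioc (0:ℝ) 1))
    (hint2 : MeasureTheory.IntegrableOn (fun l : ℝ => |deriv (deriv ψ) l|) (Set.Ioc (0:ℝ) 1))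
    (hint3 : MeasureTheory.IntegrableOn (fun l : ℝ => ψ l / l) (Set.Ioc (0:ℝ) 1))
    (C₀ : ℝ) (hC0 : ∀ p : ℝ, ψ p ≤ C₀ * p ^ 2)
    (hliminf : 0 < Filter.liminf (fun p : ℝ => ψ p / p ^ 2) (nhdsWithin (0:ℝ) ({0}ᶜ))) :
    ∃ C h₀ : ℝ, 0 < h₀ ∧ h₀ < 1 ∧ ∀ h : ℝ, 0 < h → h ≤ h₀ →
      (∫ x : ℝ, vfun ψ h x) ≤ C * h * Real.log (1 / h) := by
  obtain ⟨α, c, hα, hc, hlow⟩ := psi_lower β hβ1 ψ heven hnonneg hpos hRV hdiff1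
  obtain ⟨K, hK0, hK⟩ := psi_weight ψ heven hnonneg hdiff2 D₁ hD1 hint2 C₀ hC0 α c hc hlow
  obtain ⟨C, hC, hL1⟩ := L1_scaled α (by linarith)
  have hα0 : 0 < α := by linarith
  have hdiff : Differentiable ℝ ψ := by
    intro p
    rcases lt_trichotomy p 0 with hp | rfl | hp
    · have h1 := (hdiff1 (-p) (by linarith))
      have : DifferentiableAt ℝ (fun x => ψ (-x)) p := h1.comp p differentiableAt_id.neg
      rwa [funext heven] at this
    · exact (psi_deriv_zero ψ hnonneg C₀ hC0).differentiableAt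
    · exact hdiff1 p hp
  set J := ∫ s in (0:ℝ)..1, s ^ (-1/α) with hJ
  have hJ0 : 0 ≤ J := intervalIntegral.integral_nonneg zero_le_one fun s hs => Real.rpow_nonneg hs.1 _
  have hγ : -1 < -1/α := by
    rw [lt_div_iff₀ hα0]; linarith
  set C' := C * K * (c/2) ^ (-1/α) with hC'
  have hC'0 : 0 ≤ C' := by positivity
  refine ⟨C' * J, Real.exp (-1), Real.exp_pos _, by rw [Real.exp_lt_one_iff]; norm_num, fun h hh hh0 => ?_⟩
  have key : ∀ s, 0 < s → s ≤ 1 → ∫⁻ x, ‖pdens ψ s (x + h) - pdens ψ s x‖ₑ ≤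
      ENNReal.ofReal ((C' * h) * s ^ (-1/α)) := by
    intro s hs hs1
    have hb : 0 < s * (c/2) := by positivity
    have hKs := hK s hs hs1
    have bd := Gsym_bounds ψ hdiff h s K (s * (c/2)) α hh hs hKs
    have hGd : Differentiable ℝ (Gsym ψ h s) := fun p => (Gsym_hasDeriv ψ hdiff h s p).differentiableAt
    have hG : Integrable (Gsym ψ h s) :=
      (sq_bound _ hGd.continuous.measurable α 1 (by norm_num) hα0 (s * (c/2)) (h * K) hb (by positivity)
        (fun p => by simpa using (bd p).1)).1
    have hE : Integrable (fun p => Real.exp (-s * ψ p)) := by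
      have i := ((int_pow_exp α (s * (c/2)) 0 hα0 hb le_rfl).1.const_mul K)
      refine i.mono' (by fun_prop) (.of_forall fun p => ?_)
      rw [Real.norm_of_nonneg (Real.exp_pos _).le, Real.rpow_zero, one_mul]
      refine le_trans ?_ (hKs p)
      have : 0 ≤ s * (|p| * |deriv ψ p|) := by positivity
      nlinarith [Real.exp_pos (-s * ψ p)]
    have hF := hL1 (Gsym ψ h s) (s * (c/2)) (h * K) hb (by positivity) hGd (fun p => (bd p).1) (fun p => (bd p).2)
    rw [lintegral_dilate (2 * Real.pi) (by positivity), ← lintegral_const_mul' _ _ ENNReal.ofReal_ne_top]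
    refine (lintegral_mono fun y => ?_).trans (hF.trans (le_of_eq ?_))
    · have := diff_le_fourier ψ heven h s y hE hG
      rw [← ofReal_norm, ← ofReal_norm, ← ENNReal.ofReal_mul (by positivity)]
      apply ENNReal.ofReal_le_ofReal
      rw [Real.norm_eq_abs]
      have hpi := Real.pi_pos
      calc _ ≤ 2 * Real.pi * ((1 / (2 * Real.pi)) * ‖𝓕 (Gsym ψ h s) y‖) := by gcongr
        _ = _ := by field_simp
    · congr 1
      rw [Real.mul_rpow hs.le (by positivity), hC']
      ring
  have hv := vfun_bound ψ hmeas h (C' * h) (-1/α) (by positivity) hγ key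
  refine hv.trans ?_
  have hlog : 1 ≤ Real.log (1/h) := by
    rw [one_div, Real.log_inv]
    have := Real.log_le_log hh hh0
    rw [Real.log_exp] at this
    linarith
  have : 0 ≤ C' * h * J := by positivity
  nlinarith [mul_le_mul_of_nonneg_left hlog this]
end

section
/- For every real p ≥ 2 there exist a constant C < ∞ and h₀ > 0 such that for all 0 < h ≤ h₀, ∫_ℝ v(x)^p dx ≤ C·h/(h^{p−1}·ψ(1/h)^{p−1}). -/
section helpers

open MeasureTheory Set Filter Topology

/-- The hypotheses actually used in the proof. -/
structure Hyp (β : ℝ) (ψ : ℝ → ℝ) (D₁ D₂ C₀ : ℝ) : Prop where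
  hβ1 : 1 < β
  hmeas : Measurable ψ
  hnonneg : ∀ p : ℝ, 0 ≤ ψ p
  hpos : ∀ p : ℝ, p ≠ 0 → 0 < ψ p
  hRV : ∀ l : ℝ, 0 < l →
      Filter.Tendsto (fun x => ψ (l * x) / ψ x) Filter.atTop (nhds (l ^ β))
  hdiff1 : ∀ p : ℝ, 0 < p → DifferentiableAt ℝ ψ p
  hdiff2 : ∀ p : ℝ, 0 < p → DifferentiableAt ℝ (deriv ψ) p
  hD1 : ∀ l : ℝ, 1 ≤ l → l * |deriv ψ l| ≤ D₁ * ψ l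
  hD2 : ∀ l : ℝ, 1 ≤ l → l ^ 2 * |deriv (deriv ψ) l| ≤ D₂ * ψ l
  hint1 : MeasureTheory.IntegrableOn (fun l : ℝ => (deriv ψ l) ^ 2) (Set.Ioc (0:ℝ) 1)
  hint2 : MeasureTheory.IntegrableOn (fun l : ℝ => |deriv (deriv ψ) l|) (Set.Ioc (0:ℝ) 1)
  hC0 : ∀ p : ℝ, ψ p ≤ C₀ * p ^ 2

namespace Hyp

variable {β : ℝ} {ψ : ℝ → ℝ} {D₁ D₂ C₀ : ℝ}

lemma D1_nonneg (H : Hyp β ψ D₁ D₂ C₀) : 0 ≤ D₁ := by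
  have h1 := H.hD1 1 le_rfl
  have h2 := H.hpos 1 one_ne_zero
  have : 0 ≤ D₁ * ψ 1 := le_trans (by positivity) h1
  exact nonneg_of_mul_nonneg_left this h2

lemma D2_nonneg (H : Hyp β ψ D₁ D₂ C₀) : 0 ≤ D₂ := by
  have h1 := H.hD2 1 le_rfl
  have h2 := H.hpos 1 one_ne_zero
  have : 0 ≤ D₂ * ψ 1 := le_trans (by positivity) h1
  exact nonneg_of_mul_nonneg_left this h2

lemma comp_upper (H : Hyp β ψ D₁ D₂ C₀) {x y : ℝ} (hx : 1 ≤ x) (hxy : x ≤ y) :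
    ψ y ≤ (y / x) ^ D₁ * ψ x := by
  have hd : ∀ p : ℝ, 1 ≤ p → HasDerivAt (fun p => ψ p * p ^ (-D₁))
      (deriv ψ p * p ^ (-D₁) + ψ p * (-D₁ * p ^ (-D₁ - 1))) p := by
    intro p hp
    have hp0 : 0 < p := by linarith
    exact (H.hdiff1 p hp0).hasDerivAt.mul (Real.hasDerivAt_rpow_const (Or.inl hp0.ne'))
  have hanti : AntitoneOn (fun p => ψ p * p ^ (-D₁)) (Ici 1) := by
    apply antitoneOn_of_deriv_nonpos (convex_Ici 1)
    · intro p hp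
      exact (hd p hp).continuousAt.continuousWithinAt
    · intro p hp
      rw [interior_Ici] at hp
      exact (hd p hp.le).differentiableAt.differentiableWithinAt
    · intro p hp
      rw [interior_Ici] at hp
      have hp1 : (1:ℝ) < p := hp
      have hp0 : 0 < p := by linarith
      rw [(hd p hp1.le).deriv]
      have e : p ^ (-D₁) = p * p ^ (-D₁ - 1) := by
        rw [Real.rpow_sub_one hp0.ne']; field_simp
      rw [e]
      have h1 := H.hD1 p hp1.le
      have h2 : p * deriv ψ p ≤ D₁ * ψ p :=
        le_trans (mul_le_mul_of_nonneg_left (le_abs_self _) hp0.le) h1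
      have h3 : 0 < p ^ (-D₁ - 1) := Real.rpow_pos_of_pos hp0 _
      nlinarith
  have hx0 : 0 < x := by linarith
  have hy0 : 0 < y := by linarith
  have := hanti (show x ∈ Ici 1 from hx) (show y ∈ Ici 1 from hx.trans hxy) hxy
  simp only at this
  rw [Real.rpow_neg hx0.le, Real.rpow_neg hy0.le, ← div_eq_mul_inv, ← div_eq_mul_inv,
    div_le_div_iff₀ (by positivity) (by positivity)] at this
  rw [Real.div_rpow hy0.le hx0.le, div_mul_eq_mul_div, le_div_iff₀ (by positivity)]
  linarith

lemma comp_lower (H : Hyp β ψ D₁ D₂ C₀) {x y : ℝ} (hx : 1 ≤ x) (hxy : x ≤ y) :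
    ψ x ≤ (y / x) ^ D₁ * ψ y := by
  have hd : ∀ p : ℝ, 1 ≤ p → HasDerivAt (fun p => ψ p * p ^ D₁)
      (deriv ψ p * p ^ D₁ + ψ p * (D₁ * p ^ (D₁ - 1))) p := by
    intro p hp
    have hp0 : 0 < p := by linarith
    exact (H.hdiff1 p hp0).hasDerivAt.mul (Real.hasDerivAt_rpow_const (Or.inl hp0.ne'))
  have hmono : MonotoneOn (fun p => ψ p * p ^ D₁) (Ici 1) := by
    apply monotoneOn_of_deriv_nonneg (convex_Ici 1)
    · intro p hp
      exact (hd p hp).continuousAt.continuousWithinAt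
    · intro p hp
      rw [interior_Ici] at hp
      exact (hd p hp.le).differentiableAt.differentiableWithinAt
    · intro p hp
      rw [interior_Ici] at hp
      have hp1 : (1:ℝ) < p := hp
      have hp0 : 0 < p := by linarith
      rw [(hd p hp1.le).deriv]
      have e : p ^ D₁ = p * p ^ (D₁ - 1) := by
        rw [Real.rpow_sub_one hp0.ne']; field_simp
      rw [e]
      have h1 := H.hD1 p hp1.le
      have h2 : -(p * deriv ψ p) ≤ D₁ * ψ p := by
        refine le_trans ?_ h1
        have := neg_abs_le (deriv ψ p)
        nlinarith
      have h3 : 0 < p ^ (D₁ - 1) := Real.rpow_pos_of_pos hp0 _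
      nlinarith
  have hx0 : 0 < x := by linarith
  have hy0 : 0 < y := by linarith
  have := hmono (show x ∈ Ici 1 from hx) (show y ∈ Ici 1 from hx.trans hxy) hxy
  simp only at this
  rw [Real.div_rpow hy0.le hx0.le, div_mul_eq_mul_div, le_div_iff₀ (by positivity)]
  linarith

/-- Potter lower bound. -/
lemma potter_lower (H : Hyp β ψ D₁ D₂ C₀) {α : ℝ} (hα0 : 0 < α) (hα : α < β) :
    ∃ c : ℝ, 0 < c ∧ ∀ x y : ℝ, 1 ≤ x → x ≤ y → c * (y / x) ^ α * ψ x ≤ ψ y := by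
  have hev : ∀ᶠ x in atTop, (2:ℝ) ^ α < ψ (2 * x) / ψ x :=
    (H.hRV 2 two_pos).eventually (lt_mem_nhds (Real.rpow_lt_rpow_of_exponent_lt one_lt_two hα))
  obtain ⟨X₀, hX₀⟩ := eventually_atTop.1 hev
  set X := max X₀ 1 with hX
  have hX1 : 1 ≤ X := le_max_right _ _
  have hX0 : 0 < X := by linarith
  have step : ∀ n : ℕ, ∀ x, X ≤ x → ((2:ℝ) ^ n) ^ α * ψ x ≤ ψ (2 ^ n * x) := by
    intro n
    induction n with
    | zero => intro x hx; simp
    | succ n ih =>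
      intro x hx
      have hx0 : 0 < x := by linarith
      have h2n : (1:ℝ) ≤ 2 ^ n := one_le_pow₀ one_le_two
      have hge : X ≤ 2 ^ n * x := by nlinarith
      have h1 := hX₀ (2 ^ n * x) (le_trans (le_max_left _ _) hge)
      have hp : 0 < ψ (2 ^ n * x) := H.hpos _ (by positivity)
      rw [lt_div_iff₀ hp] at h1
      have h2 := ih x hx
      have e : (2:ℝ) ^ (n + 1) * x = 2 * (2 ^ n * x) := by ring
      rw [e, pow_succ, Real.mul_rpow (by positivity) (by positivity)]
      have h3 : (0:ℝ) < 2 ^ α := by positivity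
      nlinarith
  have h2D : (0:ℝ) < 2 ^ D₁ := by positivity
  have h2α : (0:ℝ) < 2 ^ α := by positivity
  have hXD : 0 < X ^ D₁ := by positivity
  have big : ∀ x y, X ≤ x → x ≤ y → (y / x) ^ α * ψ x ≤ 2 ^ α * 2 ^ D₁ * ψ y := by
    intro x y hx hxy
    have hx0 : 0 < x := by linarith
    have hy0 : 0 < y := by linarith
    obtain ⟨n, hn1, hn2⟩ := exists_nat_pow_near (show 1 ≤ y / x by rwa [one_le_div hx0]) one_lt_two
    have hn1' : 2 ^ n * x ≤ y := by rwa [le_div_iff₀ hx0] at hn1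
    have h2n : (1:ℝ) ≤ 2 ^ n := one_le_pow₀ one_le_two
    have hge : 1 ≤ 2 ^ n * x := by nlinarith
    have h1 := H.comp_lower hge hn1'
    have h2 : (y / (2 ^ n * x)) ^ D₁ ≤ 2 ^ D₁ := by
      apply Real.rpow_le_rpow (by positivity) _ H.D1_nonneg
      rw [div_le_iff₀ (by positivity)]
      rw [div_lt_iff₀ hx0, pow_succ] at hn2
      linarith
    have h3 : (y / x) ^ α ≤ 2 ^ α * (2 ^ n) ^ α := by
      rw [← Real.mul_rpow (by positivity) (by positivity)]
      apply Real.rpow_le_rpow (by positivity) _ hα0.le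
      rw [pow_succ] at hn2; linarith
    have hψy := H.hnonneg y
    have hψx := H.hnonneg x
    calc (y / x) ^ α * ψ x ≤ 2 ^ α * (2 ^ n) ^ α * ψ x := by gcongr
      _ = 2 ^ α * ((2 ^ n) ^ α * ψ x) := by ring
      _ ≤ 2 ^ α * (2 ^ D₁ * ψ y) := by
        refine mul_le_mul_of_nonneg_left ?_ h2α.le
        exact (step n x hx).trans (h1.trans (by gcongr))
      _ = _ := by ring
  refine ⟨(2 ^ α * 2 ^ D₁ * X ^ D₁ * X ^ D₁)⁻¹, by positivity, ?_⟩
  intro x y hx hxy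
  have hx0 : 0 < x := by linarith
  have hy0 : 0 < y := by linarith
  have b := big (X * x) (X * y) (by nlinarith) (by nlinarith)
  have e : X * y / (X * x) = y / x := by field_simp
  rw [e] at b
  have c1 := H.comp_lower hx (show x ≤ X * x by nlinarith)
  have c2 := H.comp_upper (hx.trans hxy) (show y ≤ X * y by nlinarith)
  have e1 : X * x / x = X := by field_simp
  have e2 : X * y / y = X := by field_simp
  rw [e1] at c1
  rw [e2] at c2
  rw [mul_assoc, inv_mul_le_iff₀ (by positivity)]
  have hyx : 0 < (y / x) ^ α := by positivity
  calc (y / x) ^ α * ψ x ≤ (y / x) ^ α * (X ^ D₁ * ψ (X * x)) := by gcongr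
    _ = X ^ D₁ * ((y / x) ^ α * ψ (X * x)) := by ring
    _ ≤ X ^ D₁ * (2 ^ α * 2 ^ D₁ * (X ^ D₁ * ψ y)) := by
      refine mul_le_mul_of_nonneg_left ?_ hXD.le
      exact b.trans (by gcongr)
    _ = _ := by ring

/-- Potter upper bound. -/
lemma potter_upper (H : Hyp β ψ D₁ D₂ C₀) {γ : ℝ} (hγ0 : 0 < γ) (hγ : β < γ) :
    ∃ C : ℝ, 0 < C ∧ ∀ x y : ℝ, 1 ≤ x → x ≤ y → ψ y ≤ C * (y / x) ^ γ * ψ x := by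
  have hev : ∀ᶠ x in atTop, ψ (2 * x) / ψ x < (2:ℝ) ^ γ :=
    (H.hRV 2 two_pos).eventually (gt_mem_nhds (Real.rpow_lt_rpow_of_exponent_lt one_lt_two hγ))
  obtain ⟨X₀, hX₀⟩ := eventually_atTop.1 hev
  set X := max X₀ 1 with hX
  have hX1 : 1 ≤ X := le_max_right _ _
  have hX0 : 0 < X := by linarith
  have step : ∀ n : ℕ, ∀ x, X ≤ x → ψ (2 ^ n * x) ≤ ((2:ℝ) ^ n) ^ γ * ψ x := by
    intro n
    induction n with
    | zero => intro x hx; simp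
    | succ n ih =>
      intro x hx
      have hx0 : 0 < x := by linarith
      have h2n : (1:ℝ) ≤ 2 ^ n := one_le_pow₀ one_le_two
      have hge : X ≤ 2 ^ n * x := by nlinarith
      have h1 := hX₀ (2 ^ n * x) (le_trans (le_max_left _ _) hge)
      have hp : 0 < ψ (2 ^ n * x) := H.hpos _ (by positivity)
      rw [div_lt_iff₀ hp] at h1
      have h2 := ih x hx
      have e : (2:ℝ) ^ (n + 1) * x = 2 * (2 ^ n * x) := by ring
      rw [e, pow_succ, Real.mul_rpow (by positivity) (by positivity)]
      have h3 : (0:ℝ) < 2 ^ γ := by positivity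
      nlinarith
  have h2D : (0:ℝ) < 2 ^ D₁ := by positivity
  have hXD : 0 < X ^ D₁ := by positivity
  have big : ∀ x y, X ≤ x → x ≤ y → ψ y ≤ 2 ^ D₁ * (y / x) ^ γ * ψ x := by
    intro x y hx hxy
    have hx0 : 0 < x := by linarith
    have hy0 : 0 < y := by linarith
    obtain ⟨n, hn1, hn2⟩ := exists_nat_pow_near (show 1 ≤ y / x by rwa [one_le_div hx0]) one_lt_two
    have hn1' : 2 ^ n * x ≤ y := by rwa [le_div_iff₀ hx0] at hn1
    have h2n : (1:ℝ) ≤ 2 ^ n := one_le_pow₀ one_le_two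
    have hge : 1 ≤ 2 ^ n * x := by nlinarith
    have h1 := H.comp_upper hge hn1'
    have h2 : (y / (2 ^ n * x)) ^ D₁ ≤ 2 ^ D₁ := by
      apply Real.rpow_le_rpow (by positivity) _ H.D1_nonneg
      rw [div_le_iff₀ (by positivity)]
      rw [div_lt_iff₀ hx0, pow_succ] at hn2
      linarith
    have h3 : (2 ^ n) ^ γ ≤ (y / x) ^ γ :=
      Real.rpow_le_rpow (by positivity) hn1 hγ0.le
    have hψx := H.hnonneg x
    have hψn := H.hnonneg (2 ^ n * x)
    calc ψ y ≤ 2 ^ D₁ * ψ (2 ^ n * x) := h1.trans (by gcongr)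
      _ ≤ 2 ^ D₁ * ((y / x) ^ γ * ψ x) := by
        gcongr
        exact (step n x hx).trans (by gcongr)
      _ = _ := by ring
  refine ⟨X ^ D₁ * 2 ^ D₁ * X ^ D₁, by positivity, ?_⟩
  intro x y hx hxy
  have hx0 : 0 < x := by linarith
  have hy0 : 0 < y := by linarith
  have b := big (X * x) (X * y) (by nlinarith) (by nlinarith)
  have e : X * y / (X * x) = y / x := by field_simp
  rw [e] at b
  have c1 := H.comp_upper hx (show x ≤ X * x by nlinarith)
  have c2 := H.comp_lower (hx.trans hxy) (show y ≤ X * y by nlinarith)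
  have e1 : X * x / x = X := by field_simp
  have e2 : X * y / y = X := by field_simp
  rw [e1] at c1
  rw [e2] at c2
  have hyx : 0 < (y / x) ^ γ := by positivity
  calc ψ y ≤ X ^ D₁ * (2 ^ D₁ * (y / x) ^ γ * (X ^ D₁ * ψ x)) := by
        refine c2.trans ?_
        gcongr; exact b.trans (by gcongr)
    _ = _ := by ring

/-- polynomial lower bound -/
lemma lower (H : Hyp β ψ D₁ D₂ C₀) {α : ℝ} (hα0 : 0 < α) (hα : α < β) :
    ∃ c : ℝ, 0 < c ∧ ∀ p : ℝ, 1 ≤ p → c * p ^ α ≤ ψ p := by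
  obtain ⟨c, hc, h⟩ := H.potter_lower hα0 hα
  refine ⟨c * ψ 1, mul_pos hc (H.hpos 1 one_ne_zero), fun p hp => ?_⟩
  have := h 1 p le_rfl hp
  rw [div_one] at this
  linarith

end Hyp

lemma exp_neg_bound {k x : ℝ} (hk : 0 < k) (hx : 0 < x) :
    Real.exp (-x) ≤ k ^ k * x ^ (-k) := by
  have h1 : x / k ≤ Real.exp (x / k) := by linarith [Real.add_one_le_exp (x / k)]
  have h2 : (x / k) ^ k ≤ Real.exp x := by
    calc (x / k) ^ k ≤ (Real.exp (x / k)) ^ k := Real.rpow_le_rpow (by positivity) h1 hk.le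
      _ = Real.exp x := by rw [← Real.exp_mul]; congr 1; field_simp
  rw [Real.div_rpow hx.le hk.le, div_le_iff₀ (by positivity)] at h2
  rw [Real.exp_neg, Real.rpow_neg hx.le, ← div_eq_mul_inv, inv_eq_one_div,
    div_le_div_iff₀ (Real.exp_pos _) (by positivity)]
  linarith

lemma glue_int {f g : ℝ → ℝ} (hf : IntegrableOn f (Ioc 0 1)) (hg : IntegrableOn g (Ioi 1)) :
    IntegrableOn (fun p => if p ≤ 1 then f p else g p) (Ioi 0) := by
  rw [← Ioc_union_Ioi_eq_Ioi (zero_le_one (α := ℝ))]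
  apply IntegrableOn.union
  · refine hf.congr_fun (fun p hp => ?_) measurableSet_Ioc
    simp [hp.2]
  · refine hg.congr_fun (fun p hp => ?_) measurableSet_Ioi
    have : ¬ p ≤ 1 := not_le.2 hp
    simp [this]

/-- second derivative of `p * exp (-s ψ p)` -/
noncomputable def F2 (ψ : ℝ → ℝ) (s p : ℝ) : ℝ :=
  Real.exp (-s * ψ p) * (-2 * s * deriv ψ p - s * p * deriv (deriv ψ) p
    + s ^ 2 * p * (deriv ψ p) ^ 2)

namespace Hyp

variable {β : ℝ} {ψ : ℝ → ℝ} {D₁ D₂ C₀ : ℝ}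

lemma expX (H : Hyp β ψ D₁ D₂ C₀) {α c k : ℝ} (hk : 0 < k) (hc : 0 < c)
    (hlow : ∀ p : ℝ, 1 ≤ p → c * p ^ α ≤ ψ p) {s p : ℝ} (hs : 0 < s) (hp : 1 ≤ p) :
    (s * ψ p) ^ (-k) ≤ s ^ (-k) * (c ^ (-k) * p ^ (-(α * k))) := by
  have hp0 : 0 < p := by linarith
  have h1 : s * (c * p ^ α) ≤ s * ψ p := mul_le_mul_of_nonneg_left (hlow p hp) hs.le
  have h2 : (s * ψ p) ^ (-k) ≤ (s * (c * p ^ α)) ^ (-k) :=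
    Real.rpow_le_rpow_of_nonpos (by positivity) h1 (by linarith)
  refine h2.trans (le_of_eq ?_)
  rw [Real.mul_rpow hs.le (by positivity), Real.mul_rpow hc.le (by positivity),
    ← Real.rpow_mul hp0.le]
  congr 3; ring

lemma domA (H : Hyp β ψ D₁ D₂ C₀) {θ : ℝ} (hθ : 1 / β < θ) :
    ∃ g : ℝ → ℝ, IntegrableOn g (Ioi 0) ∧ (∀ p, 0 < p → 0 ≤ g p) ∧
      ∀ s p : ℝ, 0 < s → s ≤ 1 → 0 < p → p * Real.exp (-s * ψ p) ≤ s ^ (-(2 * θ)) * g p := by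
  have hβ0 : 0 < β := by linarith [H.hβ1]
  have hθ0 : 0 < θ := lt_trans (by positivity) hθ
  obtain ⟨α, hα1, hα2⟩ := exists_between (show 1 / θ < β by
    rw [div_lt_iff₀ hθ0]; rw [div_lt_iff₀ hβ0] at hθ; linarith)
  have hα0 : 0 < α := lt_trans (by positivity) hα1
  obtain ⟨c, hc, hlow⟩ := H.lower hα0 hα2
  have hαθ : 1 < α * θ := by rwa [div_lt_iff₀ hθ0] at hα1
  set k := 2 * θ with hk
  have hk0 : 0 < k := by positivity
  refine ⟨fun p => if p ≤ 1 then 1 else k ^ k * c ^ (-k) * p ^ (1 - α * k), ?_, ?_, ?_⟩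
  · apply glue_int
    · simp
    · apply Integrable.const_mul
      exact integrableOn_Ioi_rpow_of_lt (by rw [hk]; nlinarith) one_pos
  · intro p hp
    dsimp only
    split_ifs
    · positivity
    · positivity
  · intro s p hs hs1 hp
    have hsk : 1 ≤ s ^ (-k) := Real.one_le_rpow_of_pos_of_le_one_of_nonpos hs hs1 (by linarith)
    dsimp only
    split_ifs with h
    · have : Real.exp (-s * ψ p) ≤ 1 := by
        rw [Real.exp_le_one_iff]
        nlinarith [H.hnonneg p]
      nlinarith [Real.exp_pos (-s * ψ p)]
    · have hp1 : 1 ≤ p := (not_le.1 h).le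
      have hX : 0 < s * ψ p := mul_pos hs (H.hpos p hp.ne')
      have h1 := exp_neg_bound hk0 hX
      have h2 := H.expX hk0 hc hlow hs hp1
      have e : p ^ (1 - α * k) = p * p ^ (-(α * k)) := by
        rw [sub_eq_add_neg, Real.rpow_add hp, Real.rpow_one]
      rw [e, neg_mul]
      calc p * Real.exp (-(s * ψ p)) ≤ p * (k ^ k * (s ^ (-k) * (c ^ (-k) * p ^ (-(α * k))))) := by
            refine mul_le_mul_of_nonneg_left (h1.trans ?_) hp.le
            exact mul_le_mul_of_nonneg_left h2 (by positivity)
        _ = _ := by ring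

lemma domB (H : Hyp β ψ D₁ D₂ C₀) {δ : ℝ} (hδ : 0 < δ) :
    ∃ g : ℝ → ℝ, IntegrableOn g (Ioi 0) ∧ (∀ p, 0 < p → 0 ≤ g p) ∧
      ∀ s p : ℝ, 0 < s → s ≤ 1 → 0 < p → |F2 ψ s p| ≤ s ^ (-δ) * g p := by
  have hD1 := H.D1_nonneg
  have hD2 := H.D2_nonneg
  obtain ⟨c, hc, hlow⟩ := H.lower one_pos H.hβ1
  set K : ℝ := (2 * D₁ + D₂) * (1 + δ) ^ (1 + δ) + D₁ ^ 2 * (2 + δ) ^ (2 + δ) with hK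
  have hK0 : 0 ≤ K := by positivity
  refine ⟨fun p => if p ≤ 1 then 1 + 2 * (deriv ψ p) ^ 2 + |deriv (deriv ψ) p|
      else K * c ^ (-δ) * p ^ (-1 - δ), ?_, ?_, ?_⟩
  · apply glue_int
    · refine ((integrable_const _).add (H.hint1.const_mul 2)).add H.hint2
    · apply Integrable.const_mul
      exact integrableOn_Ioi_rpow_of_lt (by linarith) one_pos
  · intro p hp
    dsimp only
    split_ifs
    · positivity
    · positivity
  · intro s p hs hs1 hp
    have hsk : 1 ≤ s ^ (-δ) := Real.one_le_rpow_of_pos_of_le_one_of_nonpos hs hs1 (by linarith)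
    have hexp : Real.exp (-s * ψ p) ≤ 1 := by
      rw [Real.exp_le_one_iff]
      nlinarith [H.hnonneg p]
    have hexp0 := Real.exp_pos (-s * ψ p)
    have htri : |F2 ψ s p| ≤ Real.exp (-s * ψ p) * (2 * s * |deriv ψ p|
        + s * p * |deriv (deriv ψ) p| + s ^ 2 * p * |deriv ψ p| ^ 2) := by
      unfold F2
      rw [abs_mul, abs_of_pos hexp0]
      refine mul_le_mul_of_nonneg_left ?_ hexp0.le
      refine (abs_add_le _ _).trans (add_le_add ((abs_sub _ _).trans (add_le_add ?_ ?_)) ?_)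
      · rw [abs_mul, abs_mul, abs_of_pos hs]; norm_num
      · rw [abs_mul, abs_mul, abs_of_pos hs, abs_of_pos hp]
      · rw [abs_mul, abs_mul, abs_of_pos hp, abs_of_pos (by positivity : 0 < s ^ 2), abs_pow]
    refine htri.trans ?_
    have ha := abs_nonneg (deriv ψ p)
    have hb := abs_nonneg (deriv (deriv ψ) p)
    dsimp only
    split_ifs with h
    · rw [← sq_abs (deriv ψ p)]
      generalize |deriv ψ p| = a at *
      generalize |deriv (deriv ψ) p| = b at *
      have h1 : 2 * s * a ≤ 1 + a ^ 2 := by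
        have : s * a ≤ 1 * a := mul_le_mul_of_nonneg_right hs1 ha
        nlinarith [sq_nonneg (a - 1)]
      have hsp : s * p ≤ 1 := by nlinarith
      have h2 : s * p * b ≤ b := by nlinarith
      have hsp2 : s ^ 2 * p ≤ 1 := by nlinarith
      have h3 : s ^ 2 * p * a ^ 2 ≤ a ^ 2 := by nlinarith [sq_nonneg a]
      have h0 : 0 ≤ 2 * s * a + s * p * b + s ^ 2 * p * a ^ 2 := by positivity
      calc Real.exp (-s * ψ p) * (2 * s * a + s * p * b + s ^ 2 * p * a ^ 2)
          ≤ 1 * (2 * s * a + s * p * b + s ^ 2 * p * a ^ 2) :=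
            mul_le_mul_of_nonneg_right hexp h0
        _ ≤ 1 * (1 + 2 * a ^ 2 + b) := by linarith
        _ ≤ _ := mul_le_mul_of_nonneg_right hsk (by positivity)
    · have hp1 : 1 ≤ p := (not_le.1 h).le
      set X := s * ψ p with hXd
      have hX : 0 < X := mul_pos hs (H.hpos p hp.ne')
      have e1 := exp_neg_bound (show 0 < 1 + δ by linarith) hX
      have e2 := exp_neg_bound (show 0 < 2 + δ by linarith) hX
      have h2 : X ^ (-δ) ≤ _ := H.expX hδ hc hlow hs hp1
      have hd1 := H.hD1 p hp1
      have hd2 := H.hD2 p hp1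
      have ee : -s * ψ p = -X := by rw [hXd]; ring
      rw [ee] at *
      have f1 : Real.exp (-X) * X ≤ (1 + δ) ^ (1 + δ) * X ^ (-δ) := by
        calc Real.exp (-X) * X ≤ ((1 + δ) ^ (1 + δ) * X ^ (-(1 + δ))) * X :=
              mul_le_mul_of_nonneg_right e1 hX.le
          _ = (1 + δ) ^ (1 + δ) * (X ^ (-(1 + δ)) * X ^ (1:ℝ)) := by rw [Real.rpow_one]; ring
          _ = _ := by rw [← Real.rpow_add hX]; congr 2; ring
      have f2 : Real.exp (-X) * X ^ 2 ≤ (2 + δ) ^ (2 + δ) * X ^ (-δ) := by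
        calc Real.exp (-X) * X ^ 2 ≤ ((2 + δ) ^ (2 + δ) * X ^ (-(2 + δ))) * X ^ 2 :=
              mul_le_mul_of_nonneg_right e2 (by positivity)
          _ = (2 + δ) ^ (2 + δ) * (X ^ (-(2 + δ)) * X ^ (2:ℝ)) := by rw [Real.rpow_two]; ring
          _ = _ := by rw [← Real.rpow_add hX]; congr 2; ring
      have g1 : p * (2 * s * |deriv ψ p|) ≤ 2 * D₁ * X := by
        rw [hXd]
        have := mul_le_mul_of_nonneg_left hd1 hs.le
        nlinarith
      have g2 : p * (s * p * |deriv (deriv ψ) p|) ≤ D₂ * X := by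
        rw [hXd]
        have := mul_le_mul_of_nonneg_left hd2 hs.le
        nlinarith
      have g3 : p * (s ^ 2 * p * |deriv ψ p| ^ 2) ≤ D₁ ^ 2 * X ^ 2 := by
        have : (s * (p * |deriv ψ p|)) ^ 2 ≤ (s * (D₁ * ψ p)) ^ 2 :=
          pow_le_pow_left₀ (by positivity) (mul_le_mul_of_nonneg_left hd1 hs.le) 2
        calc _ = (s * (p * |deriv ψ p|)) ^ 2 := by ring
          _ ≤ _ := this
          _ = _ := by rw [hXd]; ring
      have e : p * p ^ (-1 - δ) = p ^ (-(1 * δ)) := by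
        nth_rewrite 1 [← Real.rpow_one p]
        rw [← Real.rpow_add hp]; congr 1; ring
      have hmain : p * (Real.exp (-X) * (2 * s * |deriv ψ p|
        + s * p * |deriv (deriv ψ) p| + s ^ 2 * p * |deriv ψ p| ^ 2)) ≤
          p * (s ^ (-δ) * (K * c ^ (-δ) * p ^ (-1 - δ))) := by
        calc _ = Real.exp (-X) * (p * (2 * s * |deriv ψ p|)
              + p * (s * p * |deriv (deriv ψ) p|) + p * (s ^ 2 * p * |deriv ψ p| ^ 2)) := by ring
          _ ≤ Real.exp (-X) * (2 * D₁ * X + D₂ * X + D₁ ^ 2 * X ^ 2) :=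
            mul_le_mul_of_nonneg_left (by linarith) (Real.exp_pos _).le
          _ = (2 * D₁ + D₂) * (Real.exp (-X) * X) + D₁ ^ 2 * (Real.exp (-X) * X ^ 2) := by ring
          _ ≤ (2 * D₁ + D₂) * ((1 + δ) ^ (1 + δ) * X ^ (-δ))
              + D₁ ^ 2 * ((2 + δ) ^ (2 + δ) * X ^ (-δ)) := by
            gcongr
          _ = K * X ^ (-δ) := by rw [hK]; ring
          _ ≤ K * (s ^ (-δ) * (c ^ (-δ) * p ^ (-(1 * δ)))) := mul_le_mul_of_nonneg_left h2 hK0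
          _ = _ := by rw [← e]; ring
      exact le_of_mul_le_mul_left hmain hp

end Hyp

noncomputable def rr (ψ : ℝ → ℝ) (s t : ℝ) : ℝ :=
  ∫ p in Ioi (0:ℝ), Real.sin (p * t) * (p * Real.exp (-s * ψ p))

namespace Hyp

variable {β : ℝ} {ψ : ℝ → ℝ} {D₁ D₂ C₀ : ℝ}

lemma meas_exp (H : Hyp β ψ D₁ D₂ C₀) (s : ℝ) : Measurable (fun p => Real.exp (-s * ψ p)) :=
  Real.measurable_exp.comp (H.hmeas.const_mul _)

lemma int_p_exp (H : Hyp β ψ D₁ D₂ C₀) {s : ℝ} (hs : 0 < s) (hs1 : s ≤ 1) :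
    IntegrableOn (fun p => p * Real.exp (-s * ψ p)) (Ioi 0) := by
  have hβ : 1 / β < 1 := by
    rw [div_lt_one (by linarith [H.hβ1])]; exact H.hβ1
  obtain ⟨g, hg, hg0, hb⟩ := H.domA hβ
  refine Integrable.mono' (hg.const_mul (s ^ (-(2 * (1:ℝ))))) ?_ ?_
  · exact (measurable_id.mul (H.meas_exp s)).aestronglyMeasurable
  · refine (ae_restrict_iff' measurableSet_Ioi).2 (ae_of_all _ fun p hp => ?_)
    have hp0 : 0 < p := hp
    rw [Real.norm_of_nonneg (by positivity)]
    exact hb s p hs hs1 hp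

lemma int_exp (H : Hyp β ψ D₁ D₂ C₀) {s : ℝ} (hs : 0 < s) (hs1 : s ≤ 1) :
    IntegrableOn (fun p => Real.exp (-s * ψ p)) (Ioi 0) := by
  have h1 : IntegrableOn (fun _ : ℝ => (1:ℝ)) (Ioc 0 1) := by simp
  have h2 := (H.int_p_exp hs hs1).mono_set (Ioi_subset_Ioi (zero_le_one (α := ℝ)))
  refine Integrable.mono' (glue_int h1 h2) (H.meas_exp s).aestronglyMeasurable ?_
  refine (ae_restrict_iff' measurableSet_Ioi).2 (ae_of_all _ fun p hp => ?_)
  have hp0 : 0 < p := hp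
  rw [Real.norm_of_nonneg (by positivity)]
  split_ifs with h
  · rw [Real.exp_le_one_iff]
    nlinarith [H.hnonneg p]
  · have : 1 < p := not_le.1 h
    nlinarith [Real.exp_pos (-s * ψ p)]

lemma deriv_bdd (H : Hyp β ψ D₁ D₂ C₀) :
    ∃ M : ℝ, ∀ p : ℝ, 0 < p → p ≤ 1 → |deriv ψ p| ≤ M := by
  refine ⟨|deriv ψ 1| + ∫ l in Ioc (0:ℝ) 1, |deriv (deriv ψ) l|, fun p hp hp1 => ?_⟩
  have hint : IntegrableOn (deriv (deriv ψ)) (Ioc 0 1) := by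
    refine (integrable_norm_iff ?_).1 H.hint2
    exact (measurable_deriv _).aestronglyMeasurable
  have hsub : Ioc p 1 ⊆ Ioc 0 1 := Ioc_subset_Ioc_left hp.le
  have h1 : ∫ l in p..1, deriv (deriv ψ) l = deriv ψ 1 - deriv ψ p := by
    apply intervalIntegral.integral_eq_sub_of_hasDerivAt
    · intro x hx
      rw [uIcc_of_le hp1] at hx
      exact (H.hdiff2 x (lt_of_lt_of_le hp hx.1)).hasDerivAt
    · rw [intervalIntegrable_iff_integrableOn_Ioc_of_le hp1]
      exact hint.mono_set hsub
  have h2 : |∫ l in p..1, deriv (deriv ψ) l| ≤ ∫ l in Ioc (0:ℝ) 1, |deriv (deriv ψ) l| := by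
    rw [intervalIntegral.integral_of_le hp1]
    refine (abs_integral_le_integral_abs).trans ?_
    exact setIntegral_mono_set H.hint2 (ae_of_all _ fun _ => abs_nonneg _) hsub.eventuallyLE
  rw [h1] at h2
  have := abs_sub_abs_le_abs_sub (deriv ψ p) (deriv ψ 1)
  rw [abs_sub_comm] at this
  linarith

lemma int_F2 (H : Hyp β ψ D₁ D₂ C₀) {s : ℝ} (hs : 0 < s) (hs1 : s ≤ 1) :
    IntegrableOn (fun p => F2 ψ s p) (Ioi 0) := by
  obtain ⟨g, hg, hg0, hb⟩ := H.domB (δ := 1) one_pos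
  refine Integrable.mono' (hg.const_mul (s ^ (-(1:ℝ)))) ?_ ?_
  · apply Measurable.aestronglyMeasurable
    unfold F2
    have h1 := measurable_deriv ψ
    have h2 := measurable_deriv (deriv ψ)
    have h3 := H.meas_exp s
    fun_prop
  · refine (ae_restrict_iff' measurableSet_Ioi).2 (ae_of_all _ fun p hp => ?_)
    exact hb s p hs hs1 hp

lemma int_mul_sin {f : ℝ → ℝ} (hf : IntegrableOn f (Ioi 0)) (t : ℝ) :
    IntegrableOn (fun p => Real.sin (p * t) * f p) (Ioi 0) := by
  refine Integrable.mono' hf.norm ?_ ?_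
  · refine AEStronglyMeasurable.mul ?_ hf.aestronglyMeasurable
    exact (by fun_prop : Measurable fun p : ℝ => Real.sin (p * t)).aestronglyMeasurable
  · refine ae_of_all _ fun p => ?_
    rw [norm_mul]
    have := Real.abs_sin_le_one (p * t)
    rw [← Real.norm_eq_abs] at this
    nlinarith [norm_nonneg (f p)]

lemma ibp (H : Hyp β ψ D₁ D₂ C₀) {s : ℝ} (hs : 0 < s) (hs1 : s ≤ 1) (t : ℝ) :
    t ^ 2 * rr ψ s t = - ∫ p in Ioi (0:ℝ), Real.sin (p * t) * F2 ψ s p := by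
  set G : ℝ → ℝ := fun p => Real.exp (-s * ψ p) * (1 - s * p * deriv ψ p) * Real.sin (p * t)
    - t * (p * Real.exp (-s * ψ p)) * Real.cos (p * t) with hG
  set G' : ℝ → ℝ := fun p => Real.sin (p * t) * F2 ψ s p
    + t ^ 2 * (Real.sin (p * t) * (p * Real.exp (-s * ψ p))) with hG'
  have i1 := int_mul_sin (H.int_F2 hs hs1) t
  have i2 := (int_mul_sin (H.int_p_exp hs hs1) t).const_mul (t ^ 2)
  have G0 : G 0 = 0 := by simp [hG]
  have expnn : ∀ p, Real.exp (-s * ψ p) ≤ 1 := fun p => by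
    rw [Real.exp_le_one_iff]
    nlinarith [H.hnonneg p]
  have key : ∫ p in Ioi (0:ℝ), G' p = 0 - G 0 := by
    apply integral_Ioi_of_hasDerivAt_of_tendsto
    · obtain ⟨M, hM⟩ := H.deriv_bdd
      have hM0 : 0 ≤ M := (abs_nonneg _).trans (hM 1 one_pos le_rfl)
      unfold ContinuousWithinAt
      rw [G0]
      refine squeeze_zero_norm' (a := fun p => (1 + M) * |Real.sin (p * t)| + |t| * |p|) ?_ ?_
      · have hm : Icc (0:ℝ) 1 ∈ 𝓝[Ici 0] 0 := Icc_mem_nhdsGE one_pos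
        filter_upwards [hm] with p hp
        have hb : |1 - s * p * deriv ψ p| ≤ 1 + M := by
          refine (abs_sub _ _).trans ?_
          rw [abs_one]
          rcases hp.1.eq_or_lt with h0 | h0
          · rw [← h0]; simpa using hM0
          · have := hM p h0 hp.2
            rw [abs_mul, abs_of_pos (by positivity : 0 < s * p)]
            have h2 : s * p ≤ 1 := by nlinarith [hp.2]
            have : s * p * |deriv ψ p| ≤ 1 * M := by
              apply mul_le_mul h2 this (abs_nonneg _) zero_le_one
            linarith
        rw [hG, Real.norm_eq_abs]
        refine (abs_sub _ _).trans (add_le_add ?_ ?_)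
        · rw [abs_mul, abs_mul, Real.abs_exp]
          refine mul_le_mul_of_nonneg_right ?_ (abs_nonneg _)
          calc _ ≤ 1 * (1 + M) := mul_le_mul (expnn p) hb (abs_nonneg _) zero_le_one
            _ = _ := one_mul _
        · rw [abs_mul, abs_mul, abs_mul, Real.abs_exp]
          have := Real.abs_cos_le_one (p * t)
          calc |t| * (|p| * Real.exp (-s * ψ p)) * |Real.cos (p * t)|
              ≤ |t| * (|p| * 1) * 1 := by gcongr; exact expnn p
            _ = _ := by ring
      · have hc : Continuous (fun p : ℝ => (1 + M) * |Real.sin (p * t)| + |t| * |p|) := by fun_prop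
        have := hc.tendsto 0
        simp only [zero_mul, Real.sin_zero, abs_zero, mul_zero, add_zero] at this
        exact this.mono_left nhdsWithin_le_nhds
    · intro p hp
      have hp0 : 0 < p := hp
      have d1 := (H.hdiff1 p hp0).hasDerivAt
      have d2 := (H.hdiff2 p hp0).hasDerivAt
      have de : HasDerivAt (fun p => Real.exp (-s * ψ p))
          (Real.exp (-s * ψ p) * (-s * deriv ψ p)) p := (d1.const_mul (-s)).exp
      have dl : HasDerivAt (fun p : ℝ => p * t) t p := by
        simpa using (hasDerivAt_id p).mul_const t
      have ds := dl.sin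
      have dc := dl.cos
      have dq : HasDerivAt (fun p => 1 - s * p * deriv ψ p)
          (-(s * deriv ψ p + s * p * deriv (deriv ψ) p)) p := by
        have h1 : HasDerivAt (fun p : ℝ => s * p) s p := by
          simpa using (hasDerivAt_id p).const_mul s
        exact (h1.mul d2).const_sub 1
      have dF : HasDerivAt (fun p => t * (p * Real.exp (-s * ψ p)))
          (t * (1 * Real.exp (-s * ψ p) + p * (Real.exp (-s * ψ p) * (-s * deriv ψ p)))) p :=
        ((hasDerivAt_id p).mul de).const_mul t
      have := ((de.mul dq).mul ds).sub (dF.mul dc)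
      refine HasDerivAt.congr_deriv this ?_
      simp only [hG', F2, Pi.mul_apply]
      ring
    · exact i1.add i2
    · obtain ⟨c, hc, hlow⟩ := H.lower one_pos H.hβ1
      have hD1 := H.D1_nonneg
      have hXt : Tendsto (fun p => s * ψ p) atTop atTop := by
        refine tendsto_atTop_mono' atTop (f₁ := fun p => (s * c) * p) ?_ ?_
        · filter_upwards [eventually_ge_atTop 1] with p hp
          have := hlow p hp
          rw [Real.rpow_one] at this
          nlinarith
        · exact tendsto_id.const_mul_atTop (by positivity)
      set E : ℝ := D₁ + |t| / (s * c) with hE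
      have hlim : Tendsto (fun y : ℝ => Real.exp (-y) + E * (y ^ 1 * Real.exp (-y))) atTop (𝓝 0) := by
        have a1 := Real.tendsto_pow_mul_exp_neg_atTop_nhds_zero 1
        have a2 := Real.tendsto_exp_neg_atTop_nhds_zero
        simpa using a2.add (a1.const_mul E)
      refine squeeze_zero_norm' ?_ (hlim.comp hXt)
      filter_upwards [eventually_ge_atTop 1] with p hp
      have hp0 : 0 < p := by linarith
      have h1 := hlow p hp
      rw [Real.rpow_one] at h1
      have h2 := H.hD1 p hp
      have hψ := H.hnonneg p
      simp only [Function.comp, pow_one]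
      rw [hG, Real.norm_eq_abs, ← neg_mul]
      have hs1 := Real.abs_sin_le_one (p * t)
      have hc1 := Real.abs_cos_le_one (p * t)
      have b1 : |1 - s * p * deriv ψ p| ≤ 1 + D₁ * (s * ψ p) := by
        refine (abs_sub _ _).trans ?_
        rw [abs_one, abs_mul, abs_of_pos (by positivity : 0 < s * p)]
        nlinarith
      have b2 : |t| * p ≤ |t| / (s * c) * (s * ψ p) := by
        have : p ≤ ψ p / c := by rw [le_div_iff₀ hc]; linarith
        calc |t| * p ≤ |t| * (ψ p / c) := by gcongr
          _ = _ := by field_simp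
      have hex := Real.exp_pos (-s * ψ p)
      calc _ ≤ Real.exp (-s * ψ p) * (1 + D₁ * (s * ψ p)) * 1
            + |t| * (p * Real.exp (-s * ψ p)) * 1 := by
            refine (abs_sub _ _).trans (add_le_add ?_ ?_)
            · rw [abs_mul, abs_mul, Real.abs_exp]
              gcongr
            · rw [abs_mul, abs_mul, abs_mul, Real.abs_exp, abs_of_pos hp0]
              gcongr
        _ = Real.exp (-s * ψ p) + (D₁ * (s * ψ p) + |t| * p) * Real.exp (-s * ψ p) := by ring
        _ ≤ Real.exp (-s * ψ p) + (D₁ * (s * ψ p) + |t| / (s * c) * (s * ψ p))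
              * Real.exp (-s * ψ p) := by gcongr
        _ = _ := by rw [hE]; ring
  rw [G0, sub_zero] at key
  rw [hG', integral_add i1 i2, integral_const_mul] at key
  unfold rr
  linarith

lemma abs_sin_int_le {f g : ℝ → ℝ} (hg : IntegrableOn g (Ioi 0)) (a : ℝ)
    (h : ∀ p, 0 < p → |f p| ≤ a * g p) (t : ℝ) :
    |∫ p in Ioi (0:ℝ), Real.sin (p * t) * f p| ≤ a * ∫ p in Ioi (0:ℝ), g p := by
  rw [← integral_const_mul, ← Real.norm_eq_abs]
  refine norm_integral_le_of_norm_le (hg.const_mul a) ?_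
  refine (ae_restrict_iff' measurableSet_Ioi).2 (ae_of_all _ fun p hp => ?_)
  rw [norm_mul, Real.norm_eq_abs, Real.norm_eq_abs]
  calc _ ≤ 1 * |f p| := mul_le_mul_of_nonneg_right (Real.abs_sin_le_one _) (abs_nonneg _)
    _ ≤ _ := by rw [one_mul]; exact h p hp

lemma rr_bound (H : Hyp β ψ D₁ D₂ C₀) {θ δ : ℝ} (hθ : 1 / β < θ) (hδ : 0 < δ) :
    ∃ K : ℝ, 0 < K ∧ ∀ s t : ℝ, 0 < s → s ≤ 1 → |rr ψ s t| ≤ K * s ^ (-(2 * θ)) ∧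
      |rr ψ s t| ≤ K * s ^ (-(2 * θ) - δ) * (1 + (s ^ (-θ) * t) ^ 2)⁻¹ := by
  obtain ⟨gA, hgA, hgA0, hA⟩ := H.domA hθ
  obtain ⟨gB, hgB, hgB0, hB⟩ := H.domB hδ
  have iA : 0 ≤ ∫ p in Ioi (0:ℝ), gA p := setIntegral_nonneg measurableSet_Ioi fun p hp => hgA0 p hp
  have iB : 0 ≤ ∫ p in Ioi (0:ℝ), gB p := setIntegral_nonneg measurableSet_Ioi fun p hp => hgB0 p hp
  set A := ∫ p in Ioi (0:ℝ), gA p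
  set B := ∫ p in Ioi (0:ℝ), gB p
  refine ⟨A + B + 1, by positivity, fun s t hs hs1 => ?_⟩
  have h1 : |rr ψ s t| ≤ s ^ (-(2 * θ)) * A := by
    refine abs_sin_int_le hgA _ (fun p hp => ?_) t
    rw [abs_of_pos (by positivity)]
    exact hA s p hs hs1 hp
  have h2 : t ^ 2 * |rr ψ s t| ≤ s ^ (-δ) * B := by
    have e : |t ^ 2 * rr ψ s t| = t ^ 2 * |rr ψ s t| := by
      rw [abs_mul, abs_of_nonneg (sq_nonneg t)]
    rw [← e, H.ibp hs hs1 t, abs_neg]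
    exact abs_sin_int_le hgB _ (fun p hp => hB s p hs hs1 hp) t
  have hsθ : 0 < s ^ (-(2 * θ)) := Real.rpow_pos_of_pos hs _
  refine ⟨by nlinarith, ?_⟩
  rw [← div_eq_mul_inv, le_div_iff₀ (by positivity)]
  have hsk : 1 ≤ s ^ (-δ) := Real.one_le_rpow_of_pos_of_le_one_of_nonpos hs hs1 (by linarith)
  have e1 : s ^ (-(2 * θ) - δ) = s ^ (-(2 * θ)) * s ^ (-δ) := by
    rw [sub_eq_add_neg, Real.rpow_add hs]
  have e2 : (s ^ (-θ) * t) ^ 2 = s ^ (-(2 * θ)) * t ^ 2 := by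
    rw [mul_pow, ← Real.rpow_natCast, ← Real.rpow_mul hs.le]
    congr 2; push_cast; ring
  rw [e1, e2]
  generalize s ^ (-(2 * θ)) = a at *
  generalize s ^ (-δ) = b at *
  have h3 : a * (t ^ 2 * |rr ψ s t|) ≤ a * (b * B) := mul_le_mul_of_nonneg_left h2 hsθ.le
  have h4 : a * A ≤ a * b * A := by
    have : 0 ≤ a * A := by positivity
    nlinarith
  have h5 : 0 ≤ a * b := by positivity
  nlinarith

end Hyp

namespace Hyp

variable {β : ℝ} {ψ : ℝ → ℝ} {D₁ D₂ C₀ : ℝ}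

lemma meas_pdens (H : Hyp β ψ D₁ D₂ C₀) : Measurable (fun z : ℝ × ℝ => pdens ψ z.1 z.2) := by
  unfold pdens
  apply Measurable.const_mul
  have hψ := H.hmeas
  have : StronglyMeasurable (fun w : (ℝ × ℝ) × ℝ =>
      Real.cos (w.2 * w.1.2) * Real.exp (-w.1.1 * ψ w.2)) := by
    apply Measurable.stronglyMeasurable
    fun_prop
  exact (this.integral_prod_right' (ν := volume.restrict (Ioi 0))).measurable

lemma meas_delta (H : Hyp β ψ D₁ D₂ C₀) (h : ℝ) :
    Measurable (fun z : ℝ × ℝ => ENNReal.ofReal |pdens ψ z.1 (z.2 + h) - pdens ψ z.1 z.2|) := by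
  have h0 : Measurable (fun z : ℝ × ℝ => ((z.1, z.2 + h) : ℝ × ℝ)) := by fun_prop
  have h1 := H.meas_pdens.comp h0
  simp only [Function.comp_def] at h1
  have h2 := (h1.sub H.meas_pdens).norm.ennreal_ofReal
  simpa [Real.norm_eq_abs] using h2

lemma meas_rr (H : Hyp β ψ D₁ D₂ C₀) (s : ℝ) : Measurable (rr ψ s) := by
  unfold rr
  have hψ := H.hmeas
  have : StronglyMeasurable (fun w : ℝ × ℝ =>
      Real.sin (w.2 * w.1) * (w.2 * Real.exp (-s * ψ w.2))) := by
    apply Measurable.stronglyMeasurable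
    fun_prop
  exact (this.integral_prod_right' (ν := volume.restrict (Ioi 0))).measurable

lemma int_cos_exp (H : Hyp β ψ D₁ D₂ C₀) {s : ℝ} (hs : 0 < s) (hs1 : s ≤ 1) (x : ℝ) :
    IntegrableOn (fun p => Real.cos (p * x) * Real.exp (-s * ψ p)) (Ioi 0) := by
  have hψ := H.hmeas
  refine Integrable.mono' (H.int_exp hs hs1) ?_ ?_
  · exact (by fun_prop : Measurable fun p : ℝ =>
      Real.cos (p * x) * Real.exp (-s * ψ p)).aestronglyMeasurable
  · refine ae_of_all _ fun p => ?_
    rw [norm_mul, Real.norm_eq_abs, Real.norm_eq_abs, Real.abs_exp]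
    have := Real.abs_cos_le_one (p * x)
    nlinarith [Real.exp_pos (-s * ψ p)]

lemma delta_eq (H : Hyp β ψ D₁ D₂ C₀) {s : ℝ} (hs : 0 < s) (hs1 : s ≤ 1) (h x : ℝ) :
    pdens ψ s (x + h) - pdens ψ s x = (1 / Real.pi) * ∫ p in Ioi (0:ℝ),
      (Real.cos (p * (x + h)) - Real.cos (p * x)) * Real.exp (-s * ψ p) := by
  unfold pdens
  rw [← mul_sub, ← integral_sub (H.int_cos_exp hs hs1 _) (H.int_cos_exp hs hs1 _)]
  congr 2
  funext p
  ring

lemma delta_rr (H : Hyp β ψ D₁ D₂ C₀) {s : ℝ} (hs : 0 < s) (hs1 : s ≤ 1) (h x : ℝ) :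
    pdens ψ s (x + h) - pdens ψ s x = -((1 / Real.pi) * ∫ u in (0:ℝ)..h, rr ψ s (x + u)) := by
  rw [H.delta_eq hs hs1, ← mul_neg]
  congr 1
  have hψ := H.hmeas
  have hint : Integrable (Function.uncurry fun u p : ℝ =>
      Real.sin (p * (x + u)) * (p * Real.exp (-s * ψ p)))
      ((volume.restrict (uIoc 0 h)).prod (volume.restrict (Ioi 0))) := by
    have hdom : Integrable (fun z : ℝ × ℝ => (1:ℝ) * (z.2 * Real.exp (-s * ψ z.2)))
        ((volume.restrict (uIoc 0 h)).prod (volume.restrict (Ioi 0))) := by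
      refine Integrable.mul_prod (f := fun _ => (1:ℝ)) (g := fun p => p * Real.exp (-s * ψ p)) ?_ (H.int_p_exp hs hs1)
      rw [uIoc]
      simp
    refine Integrable.mono hdom ?_ ?_
    · apply Measurable.aestronglyMeasurable
      unfold Function.uncurry
      fun_prop
    · refine ae_of_all _ fun z => ?_
      simp only [Function.uncurry]
      rw [one_mul, norm_mul]
      exact mul_le_of_le_one_left (norm_nonneg _) (Real.abs_sin_le_one _)
  unfold rr
  rw [intervalIntegral_integral_swap hint, ← integral_neg]
  refine setIntegral_congr_fun measurableSet_Ioi fun p hp => ?_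
  rw [intervalIntegral.integral_mul_const]
  have : ∫ u in (0:ℝ)..h, (-p) * Real.sin (p * (x + u)) =
      Real.cos (p * (x + h)) - Real.cos (p * (x + 0)) := by
    apply intervalIntegral.integral_eq_sub_of_hasDerivAt (f := fun u => Real.cos (p * (x + u)))
    · intro u _
      have d : HasDerivAt (fun u : ℝ => p * (x + u)) p u := by
        simpa using ((hasDerivAt_id u).const_add x).const_mul p
      refine d.cos.congr_deriv (by ring)
    · apply Continuous.intervalIntegrable
      fun_prop
  rw [intervalIntegral.integral_const_mul, add_zero] at this
  rw [← this]
  ring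

lemma one_div_pi_le : 1 / Real.pi ≤ 1 := by
  rw [div_le_one Real.pi_pos]
  linarith [Real.pi_gt_three]

lemma delta_bounds (H : Hyp β ψ D₁ D₂ C₀) {θ δ : ℝ} (hθ : 1 / β < θ) (hδ : 0 < δ) :
    ∃ K : ℝ, 0 < K ∧ ∀ s h : ℝ, 0 < s → s ≤ 1 → 0 < h →
      (∀ x, |pdens ψ s (x + h) - pdens ψ s x| ≤ K * h * s ^ (-(2 * θ))) ∧
      ∫⁻ x, ENNReal.ofReal |pdens ψ s (x + h) - pdens ψ s x| ≤
        ENNReal.ofReal (K * h * s ^ (-θ - δ)) := by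
  obtain ⟨K, hK, hb⟩ := H.rr_bound hθ hδ
  have hpi := Real.pi_pos
  have hpi1 : 1 ≤ Real.pi := by linarith [Real.pi_gt_three]
  refine ⟨K * Real.pi, by positivity, fun s h hs hs1 hh => ⟨fun x => ?_, ?_⟩⟩
  · rw [H.delta_rr hs hs1, abs_neg, abs_mul, abs_of_pos (by positivity : 0 < 1 / Real.pi)]
    have h1 : |∫ u in (0:ℝ)..h, rr ψ s (x + u)| ≤ K * s ^ (-(2 * θ)) * |h - 0| := by
      rw [← Real.norm_eq_abs]
      refine intervalIntegral.norm_integral_le_of_norm_le_const fun u _ => ?_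
      exact (hb s _ hs hs1).1
    rw [sub_zero, abs_of_pos hh] at h1
    have h0 : 0 ≤ K * s ^ (-(2 * θ)) * h := by positivity
    calc _ ≤ 1 * (K * s ^ (-(2 * θ)) * h) :=
          mul_le_mul one_div_pi_le h1 (abs_nonneg _) zero_le_one
      _ ≤ Real.pi * (K * s ^ (-(2 * θ)) * h) := mul_le_mul_of_nonneg_right hpi1 h0
      _ = _ := by ring
  · set m : ℝ → ℝ := fun t => K * s ^ (-(2 * θ) - δ) * (1 + (s ^ (-θ) * t) ^ 2)⁻¹ with hm
    have hR : 0 < s ^ (-θ) := Real.rpow_pos_of_pos hs _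
    have hmm : Measurable m := by rw [hm]; fun_prop
    have pt : ∀ x, ENNReal.ofReal |pdens ψ s (x + h) - pdens ψ s x| ≤
        ∫⁻ u in Ioc 0 h, ENNReal.ofReal (m (x + u)) := by
      intro x
      rw [H.delta_rr hs hs1, abs_neg, abs_mul, abs_of_pos (by positivity : 0 < 1 / Real.pi),
        intervalIntegral.integral_of_le hh.le]
      calc _ ≤ ENNReal.ofReal |∫ u in Ioc 0 h, rr ψ s (x + u)| := by
            apply ENNReal.ofReal_le_ofReal
            have := mul_le_mul_of_nonneg_right one_div_pi_le
              (abs_nonneg (∫ u in Ioc 0 h, rr ψ s (x + u)))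
            linarith
        _ ≤ ∫⁻ u in Ioc 0 h, ‖rr ψ s (x + u)‖ₑ := by
            rw [← Real.enorm_eq_ofReal_abs]
            exact enorm_integral_le_lintegral_enorm _
        _ ≤ _ := by
            refine lintegral_mono fun u => ?_
            rw [Real.enorm_eq_ofReal_abs]
            exact ENNReal.ofReal_le_ofReal (hb s _ hs hs1).2
    have im : Integrable m := by
      refine Integrable.const_mul ?_ _
      exact integrable_inv_one_add_sq.comp_mul_left' hR.ne'
    have m0 : ∀ t, 0 ≤ m t := fun t => by rw [hm]; positivity
    have Im : ∫ t, m t = K * s ^ (-θ - δ) * Real.pi := by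
      rw [hm, integral_const_mul, Measure.integral_comp_mul_left (fun y : ℝ => (1 + y ^ 2)⁻¹),
        integral_univ_inv_one_add_sq, abs_of_pos (by positivity), smul_eq_mul,
        ← Real.rpow_neg hs.le, neg_neg]
      have : s ^ (-θ - δ) = s ^ (-(2 * θ) - δ) * s ^ θ := by
        rw [← Real.rpow_add hs]; congr 1; ring
      rw [this]; ring
    calc _ ≤ ∫⁻ x, ∫⁻ u in Ioc 0 h, ENNReal.ofReal (m (x + u)) := lintegral_mono pt
      _ = ∫⁻ u in Ioc 0 h, ∫⁻ x, ENNReal.ofReal (m (x + u)) := by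
          apply lintegral_lintegral_swap
          apply Measurable.aemeasurable
          unfold Function.uncurry
          fun_prop
      _ = ∫⁻ u in Ioc 0 h, ENNReal.ofReal (K * s ^ (-θ - δ) * Real.pi) := by
          refine lintegral_congr fun u => ?_
          rw [lintegral_add_right_eq_self (fun x => ENNReal.ofReal (m x)) u, ← Im,
            ofReal_integral_eq_lintegral_ofReal im (ae_of_all _ m0)]
      _ = _ := by
          rw [lintegral_const, Measure.restrict_apply_univ, Real.volume_Ioc, sub_zero,
            ← ENNReal.ofReal_mul (by positivity)]
          congr 1; ring

lemma inner_s (H : Hyp β ψ D₁ D₂ C₀) (p : ℝ) (hp : 0 < p) :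
    ∫⁻ s in Ioc (0:ℝ) 1, ENNReal.ofReal (Real.exp (-s * ψ p)) ≤
      ENNReal.ofReal (min 1 (1 / ψ p)) := by
  have hψ := H.hpos p hp.ne'
  rw [ENNReal.ofReal_min]
  refine le_min ?_ ?_
  · calc _ ≤ ∫⁻ s in Ioc (0:ℝ) 1, ENNReal.ofReal 1 := by
          refine setLIntegral_mono' measurableSet_Ioc fun s hs => ?_
          apply ENNReal.ofReal_le_ofReal
          rw [Real.exp_le_one_iff]
          nlinarith [hs.1]
      _ = _ := by simp
  · calc _ ≤ ∫⁻ s in Ioi (0:ℝ), ENNReal.ofReal (Real.exp (-s * ψ p)) :=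
          lintegral_mono_set Ioc_subset_Ioi_self
      _ = ENNReal.ofReal (∫ s in Ioi (0:ℝ), Real.exp (-s * ψ p)) := by
          rw [ofReal_integral_eq_lintegral_ofReal]
          · have := integrableOn_exp_mul_Ioi (a := -ψ p) (by linarith) 0
            refine this.congr_fun (fun s _ => ?_) measurableSet_Ioi
            dsimp only; congr 1; ring
          · exact ae_of_all _ fun s => (Real.exp_pos _).le
      _ = _ := by
          have := integral_exp_mul_Ioi (a := -ψ p) (by linarith) 0
          congr 1
          calc _ = ∫ s in Ioi (0:ℝ), Real.exp (-ψ p * s) := by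
                congr 1; funext s; congr 1; ring
            _ = _ := by rw [this]; simp

lemma sup_bound (H : Hyp β ψ D₁ D₂ C₀) (hβ : β < 2) :
    ∃ C : ℝ, 0 < C ∧ ∀ h x : ℝ, 0 < h → h ≤ 1 →
      ∫⁻ s in Ioc (0:ℝ) 1, ENNReal.ofReal |pdens ψ s (x + h) - pdens ψ s x| ≤
        ENNReal.ofReal (C / (h * ψ (1 / h))) := by
  obtain ⟨γ, hγ1, hγ2⟩ := exists_between hβ
  obtain ⟨α, hα1, hα2⟩ := exists_between H.hβ1
  obtain ⟨c, hc, hlo⟩ := H.potter_lower (by linarith) hα2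
  obtain ⟨C, hC, hup⟩ := H.potter_upper (by linarith [H.hβ1]) hγ1
  set k : ℝ → ℝ := fun u => if u ≤ 1 then C * u ^ (1 - γ) else 2 / c * u ^ (-α) with hk
  have ik : IntegrableOn k (Ioi 0) := by
    apply glue_int
    · apply Integrable.const_mul
      have := intervalIntegral.intervalIntegrable_rpow' (a := 0) (b := 1)
        (show -1 < 1 - γ by linarith)
      rwa [intervalIntegrable_iff_integrableOn_Ioc_of_le zero_le_one] at this
    · apply Integrable.const_mul
      exact integrableOn_Ioi_rpow_of_lt (by linarith) one_pos
  have k0 : ∀ u, 0 < u → 0 ≤ k u := fun u hu => by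
    rw [hk]; dsimp only; split_ifs <;> positivity
  set j : ℝ → ℝ := fun u => if u ≤ 1 then (1:ℝ) else 0 with hj
  have ij : IntegrableOn j (Ioi 0) := by
    apply glue_int <;> simp
  have j0 : ∀ u, 0 ≤ j u := fun u => by
    rw [hj]; dsimp only; split_ifs <;> positivity
  have J0 : 0 ≤ ∫ p in Ioi (0:ℝ), j p := integral_nonneg j0
  have K0 : 0 ≤ ∫ p in Ioi (0:ℝ), k p := setIntegral_nonneg measurableSet_Ioi fun p hp => k0 p hp
  have hC0 : 0 ≤ C₀ := by
    have := (H.hnonneg 1).trans (H.hC0 1)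
    simpa using this
  refine ⟨C₀ * (∫ p in Ioi (0:ℝ), j p) + (∫ p in Ioi (0:ℝ), k p) + 1, by positivity, ?_⟩
  intro h x hh hh1
  have hψh : 0 < ψ (1 / h) := H.hpos _ (by positivity)
  have h1h : 1 ≤ 1 / h := by rwa [le_div_iff₀ hh, one_mul]
  have hψm := H.hmeas
  -- pointwise in s
  have pt : ∀ s ∈ Ioc (0:ℝ) 1, ENNReal.ofReal |pdens ψ s (x + h) - pdens ψ s x| ≤
      ∫⁻ p in Ioi (0:ℝ), ENNReal.ofReal (min 2 (p * h)) * ENNReal.ofReal (Real.exp (-s * ψ p)) := by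
    intro s hs
    rw [H.delta_eq hs.1 hs.2, abs_mul, abs_of_pos (by positivity : 0 < 1 / Real.pi)]
    calc _ ≤ ENNReal.ofReal |∫ p in Ioi (0:ℝ),
          (Real.cos (p * (x + h)) - Real.cos (p * x)) * Real.exp (-s * ψ p)| := by
          apply ENNReal.ofReal_le_ofReal
          have := mul_le_mul_of_nonneg_right one_div_pi_le
            (abs_nonneg (∫ p in Ioi (0:ℝ),
          (Real.cos (p * (x + h)) - Real.cos (p * x)) * Real.exp (-s * ψ p)))
          linarith
      _ ≤ ∫⁻ p in Ioi (0:ℝ), ‖(Real.cos (p * (x + h)) - Real.cos (p * x)) *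
            Real.exp (-s * ψ p)‖ₑ := by
          rw [← Real.enorm_eq_ofReal_abs]
          exact enorm_integral_le_lintegral_enorm _
      _ ≤ _ := by
          refine setLIntegral_mono' measurableSet_Ioi fun p hp => ?_
          have hp0 : 0 < p := hp
          rw [Real.enorm_eq_ofReal_abs, ← ENNReal.ofReal_mul (by positivity), abs_mul,
            Real.abs_exp]
          apply ENNReal.ofReal_le_ofReal
          refine mul_le_mul_of_nonneg_right (le_min ?_ ?_) (Real.exp_pos _).le
          · refine (abs_sub _ _).trans ?_
            linarith [Real.abs_cos_le_one (p * (x + h)), Real.abs_cos_le_one (p * x)]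
          · have := Real.abs_cos_sub_cos_le (x := p * (x + h)) (y := p * x)
            refine this.trans (le_of_eq ?_)
            rw [← mul_sub, add_sub_cancel_left, abs_of_pos (by positivity)]
  have hdom : ∀ p ∈ Ioi (0:ℝ), min 2 (p * h) * min 1 (1 / ψ p) ≤
      h * j p + (ψ (1 / h))⁻¹ * k (h * p) := by
    intro p hp
    have hp0 : 0 < p := hp
    have hψp : 0 < ψ p := H.hpos p hp0.ne'
    by_cases hp1 : p ≤ 1
    · have e : j p = 1 := by simp [hj, hp1]
      rw [e]
      have : 0 ≤ (ψ (1 / h))⁻¹ * k (h * p) := mul_nonneg (by positivity) (k0 _ (by positivity))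
      have h1 : min 2 (p * h) * min 1 (1 / ψ p) ≤ (p * h) * 1 :=
        mul_le_mul (min_le_right _ _) (min_le_left _ _) (by positivity) (by positivity)
      nlinarith
    · have hp1' : 1 ≤ p := (not_le.1 hp1).le
      have e : j p = 0 := by simp [hj, hp1]
      rw [e, mul_zero, zero_add]
      by_cases hph : h * p ≤ 1
      · have e2 : k (h * p) = C * (h * p) ^ (1 - γ) := by simp [hk, hph]
        rw [e2]
        have hb := hup p (1 / h) hp1' (by rw [le_div_iff₀ hh]; linarith)
        have e3 : 1 / h / p = (h * p)⁻¹ := by field_simp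
        rw [e3, Real.inv_rpow (by positivity)] at hb
        calc min 2 (p * h) * min 1 (1 / ψ p) ≤ (p * h) * (1 / ψ p) :=
              mul_le_mul (min_le_right _ _) (min_le_right _ _) (by positivity) (by positivity)
          _ ≤ (p * h) * (C * ((h * p) ^ γ)⁻¹ / ψ (1 / h)) := by
              refine mul_le_mul_of_nonneg_left ?_ (by positivity)
              rw [div_le_div_iff₀ hψp hψh]
              linarith
          _ = _ := by
              rw [Real.rpow_sub (by positivity), Real.rpow_one]
              field_simp
      · have e2 : k (h * p) = 2 / c * (h * p) ^ (-α) := by simp [hk, hph]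
        rw [e2]
        have hb := hlo (1 / h) p h1h (by rw [div_le_iff₀ hh]; linarith)
        have e3 : p / (1 / h) = h * p := by field_simp
        rw [e3] at hb
        calc min 2 (p * h) * min 1 (1 / ψ p) ≤ 2 * (1 / ψ p) :=
              mul_le_mul (min_le_left _ _) (min_le_right _ _) (by positivity) (by positivity)
          _ ≤ 2 * (1 / (c * (h * p) ^ α * ψ (1 / h))) := by
              refine mul_le_mul_of_nonneg_left ?_ (by positivity)
              exact one_div_le_one_div_of_le (by positivity) hb
          _ = _ := by
              rw [Real.rpow_neg (by positivity)]
              field_simp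
  have ikh : IntegrableOn (fun p => k (h * p)) (Ioi 0) := by
    have := (integrableOn_Ioi_comp_mul_left_iff k 0 hh).2
    rw [mul_zero] at this
    exact this ik
  have itot : IntegrableOn (fun p => h * j p + (ψ (1 / h))⁻¹ * k (h * p)) (Ioi 0) :=
    (ij.const_mul h).add (ikh.const_mul _)
  calc _ ≤ ∫⁻ s in Ioc (0:ℝ) 1, ∫⁻ p in Ioi (0:ℝ), ENNReal.ofReal (min 2 (p * h)) *
        ENNReal.ofReal (Real.exp (-s * ψ p)) := setLIntegral_mono' measurableSet_Ioc pt
    _ = ∫⁻ p in Ioi (0:ℝ), ∫⁻ s in Ioc (0:ℝ) 1, ENNReal.ofReal (min 2 (p * h)) *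
        ENNReal.ofReal (Real.exp (-s * ψ p)) := by
        apply lintegral_lintegral_swap
        apply Measurable.aemeasurable
        unfold Function.uncurry
        fun_prop
    _ ≤ ∫⁻ p in Ioi (0:ℝ), ENNReal.ofReal (h * j p + (ψ (1 / h))⁻¹ * k (h * p)) := by
        refine setLIntegral_mono' measurableSet_Ioi fun p hp => ?_
        have hp0 : 0 < p := hp
        rw [lintegral_const_mul' _ _ ENNReal.ofReal_ne_top]
        calc _ ≤ ENNReal.ofReal (min 2 (p * h)) * ENNReal.ofReal (min 1 (1 / ψ p)) :=
              mul_le_mul_right (H.inner_s p hp) _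
          _ = ENNReal.ofReal (min 2 (p * h) * min 1 (1 / ψ p)) :=
              (ENNReal.ofReal_mul (by positivity)).symm
          _ ≤ _ := ENNReal.ofReal_le_ofReal (hdom p hp)
    _ = ENNReal.ofReal (∫ p in Ioi (0:ℝ), (h * j p + (ψ (1 / h))⁻¹ * k (h * p))) := by
        rw [ofReal_integral_eq_lintegral_ofReal itot]
        refine (ae_restrict_iff' measurableSet_Ioi).2 (ae_of_all _ fun p hp => ?_)
        have hp0 : 0 < p := hp
        have := k0 (h * p) (by positivity)
        have := j0 p
        simp only [Pi.zero_apply]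
        positivity
    _ ≤ _ := by
        apply ENNReal.ofReal_le_ofReal
        rw [integral_add (ij.const_mul h) (ikh.const_mul _), integral_const_mul,
          integral_const_mul, integral_comp_mul_left_Ioi k 0 hh, mul_zero, smul_eq_mul,
          le_div_iff₀ (by positivity)]
        have hq := H.hC0 (1 / h)
        have hq2 : h ^ 2 * ψ (1 / h) ≤ C₀ := by
          calc _ ≤ h ^ 2 * (C₀ * (1 / h) ^ 2) := by gcongr
            _ = C₀ := by field_simp
        have e : (h * (∫ p in Ioi (0:ℝ), j p) + (ψ (1 / h))⁻¹ * (h⁻¹ * ∫ p in Ioi (0:ℝ), k p)) *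
            (h * ψ (1 / h)) = (h ^ 2 * ψ (1 / h)) * (∫ p in Ioi (0:ℝ), j p)
              + ∫ p in Ioi (0:ℝ), k p := by
          field_simp
        rw [e]
        have := mul_le_mul_of_nonneg_right hq2 J0
        linarith

end Hyp

/-- the upper bound of `vfun` as an extended nonnegative real -/
noncomputable def WW (ψ : ℝ → ℝ) (h x : ℝ) : ENNReal :=
  ∫⁻ s in Ioc (0:ℝ) 1, ENNReal.ofReal |pdens ψ s (x + h) - pdens ψ s x|

lemma vfun_nonneg (ψ : ℝ → ℝ) (h x : ℝ) : 0 ≤ vfun ψ h x := by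
  unfold vfun
  exact intervalIntegral.integral_nonneg zero_le_one fun _ _ => abs_nonneg _

lemma vfun_le_WW (ψ : ℝ → ℝ) (h x : ℝ) : ENNReal.ofReal (vfun ψ h x) ≤ WW ψ h x := by
  rw [← abs_of_nonneg (vfun_nonneg ψ h x), ← Real.enorm_eq_ofReal_abs]
  unfold vfun WW
  rw [intervalIntegral.integral_of_le zero_le_one]
  refine (enorm_integral_le_lintegral_enorm _).trans (le_of_eq ?_)
  refine lintegral_congr fun s => ?_
  rw [Real.enorm_eq_ofReal_abs, abs_abs]

lemma int_le_of_WW {ψ : ℝ → ℝ} {h q B : ℝ} (hq : 0 ≤ q) (hB : 0 ≤ B)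
    (hW : ∫⁻ x, WW ψ h x ^ q ≤ ENNReal.ofReal B) : ∫ x : ℝ, vfun ψ h x ^ q ≤ B := by
  rw [← ENNReal.ofReal_le_ofReal_iff hB]
  refine le_trans ?_ hW
  rw [← abs_of_nonneg (integral_nonneg fun x => Real.rpow_nonneg (vfun_nonneg ψ h x) q),
    ← Real.enorm_eq_ofReal_abs]
  refine (enorm_integral_le_lintegral_enorm _).trans (lintegral_mono fun x => ?_)
  rw [Real.enorm_eq_ofReal_abs, abs_of_nonneg (Real.rpow_nonneg (vfun_nonneg ψ h x) q),
    ← ENNReal.ofReal_rpow_of_nonneg (vfun_nonneg ψ h x) hq]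
  exact ENNReal.rpow_le_rpow (vfun_le_WW ψ h x) hq

lemma lint_rpow {c e : ℝ} (hc : 0 ≤ c) (he : -1 < e) :
    ∫⁻ s in Ioc (0:ℝ) 1, ENNReal.ofReal (c * s ^ e) = ENNReal.ofReal (c * (1 / (e + 1))) := by
  have hi : IntegrableOn (fun s : ℝ => s ^ e) (Ioc 0 1) := by
    have := intervalIntegral.intervalIntegrable_rpow' (a := 0) (b := 1) he
    rwa [intervalIntegrable_iff_integrableOn_Ioc_of_le zero_le_one] at this
  rw [← ofReal_integral_eq_lintegral_ofReal (hi.const_mul c), integral_const_mul,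
    ← intervalIntegral.integral_of_le zero_le_one, integral_rpow (Or.inl he)]
  · rw [Real.one_rpow, Real.zero_rpow (by linarith), sub_zero]
  · refine (ae_restrict_iff' measurableSet_Ioc).2 (ae_of_all _ fun s hs => ?_)
    have := Real.rpow_nonneg hs.1.le e
    simp only [Pi.zero_apply]
    positivity

namespace Hyp

variable {β : ℝ} {ψ : ℝ → ℝ} {D₁ D₂ C₀ : ℝ}

lemma meas_delta_swap (H : Hyp β ψ D₁ D₂ C₀) (h : ℝ) :
    Measurable (fun z : ℝ × ℝ => ENNReal.ofReal |pdens ψ z.2 (z.1 + h) - pdens ψ z.2 z.1|) := by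
  have h0 := (H.meas_delta h).comp measurable_swap
  simpa only [Function.comp_def, Prod.fst_swap, Prod.snd_swap] using h0

lemma meas_delta_s (H : Hyp β ψ D₁ D₂ C₀) (h x : ℝ) :
    Measurable (fun s : ℝ => ENNReal.ofReal |pdens ψ s (x + h) - pdens ψ s x|) := by
  have h1 : Measurable (fun s : ℝ => ((s, x) : ℝ × ℝ)) := by fun_prop
  have h0 := (H.meas_delta h).comp h1
  simpa only [Function.comp_def] using h0

lemma swap_WW (H : Hyp β ψ D₁ D₂ C₀) (h : ℝ) :
    ∫⁻ x, WW ψ h x = ∫⁻ s in Ioc (0:ℝ) 1, ∫⁻ x,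
      ENNReal.ofReal |pdens ψ s (x + h) - pdens ψ s x| := by
  unfold WW
  apply lintegral_lintegral_swap
  apply Measurable.aemeasurable
  unfold Function.uncurry
  exact H.meas_delta_swap h

lemma case_lt (H : Hyp β ψ D₁ D₂ C₀) (hβ : β < 2) {q : ℝ} (hq : 2 ≤ q) :
    ∃ C : ℝ, ∀ h : ℝ, 0 < h → h ≤ 1 →
      (∫ x : ℝ, vfun ψ h x ^ q) ≤ C * h / (h ^ (q - 1) * ψ (1 / h) ^ (q - 1)) := by
  have hb1 : 1 / β < 1 := by
    rw [div_lt_one (by linarith [H.hβ1])]; exact H.hβ1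
  obtain ⟨θ, hθ1, hθ2⟩ := exists_between hb1
  obtain ⟨K, hK, hb⟩ := H.delta_bounds hθ1 (show 0 < (1 - θ) / 2 by linarith)
  obtain ⟨C, hC, hsup⟩ := H.sup_bound hβ
  set δ := (1 - θ) / 2 with hδ
  have he : -1 < -θ - δ := by rw [hδ]; linarith
  refine ⟨C ^ (q - 1) * (K * (1 / (-θ - δ + 1))), fun h hh hh1 => ?_⟩
  have hψh : 0 < ψ (1 / h) := H.hpos _ (by positivity)
  have hden : 0 < -θ - δ + 1 := by linarith
  apply int_le_of_WW (by linarith) (by positivity)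
  have hM : 0 ≤ C / (h * ψ (1 / h)) := by positivity
  have hL : ∫⁻ x, WW ψ h x ≤ ENNReal.ofReal (K * h * (1 / (-θ - δ + 1))) := by
    rw [H.swap_WW, ← lint_rpow (by positivity) he]
    exact setLIntegral_mono' measurableSet_Ioc fun s hs => (hb s h hs.1 hs.2 hh).2
  calc ∫⁻ x, WW ψ h x ^ q
      ≤ ∫⁻ x, ENNReal.ofReal (C / (h * ψ (1 / h))) ^ (q - 1) * WW ψ h x := by
        refine lintegral_mono fun x => ?_
        have e : WW ψ h x ^ q = WW ψ h x ^ (q - 1) * WW ψ h x := by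
          nth_rewrite 3 [← ENNReal.rpow_one (WW ψ h x)]
          rw [← ENNReal.rpow_add_of_nonneg _ _ (by linarith) zero_le_one]
          congr 1; ring
        rw [e]
        exact mul_le_mul_left (ENNReal.rpow_le_rpow (hsup h x hh hh1) (by linarith)) _
    _ = ENNReal.ofReal (C / (h * ψ (1 / h))) ^ (q - 1) * ∫⁻ x, WW ψ h x := by
        apply lintegral_const_mul'
        exact ENNReal.rpow_ne_top_of_nonneg (by linarith) ENNReal.ofReal_ne_top
    _ ≤ ENNReal.ofReal (C / (h * ψ (1 / h))) ^ (q - 1) *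
          ENNReal.ofReal (K * h * (1 / (-θ - δ + 1))) := mul_le_mul_right hL _
    _ = _ := by
        rw [ENNReal.ofReal_rpow_of_nonneg hM (by linarith), ← ENNReal.ofReal_mul (by positivity),
          Real.div_rpow hC.le (by positivity), Real.mul_rpow hh.le hψh.le]
        congr 1
        ring

lemma holder_WW (H : Hyp β ψ D₁ D₂ C₀) {q a : ℝ} (hq : 2 ≤ q) (ha : a * q < q - 1) :
    ∃ A : ENNReal, A ≠ ⊤ ∧ ∀ h x : ℝ, WW ψ h x ^ q ≤ A * ∫⁻ s in Ioc (0:ℝ) 1,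
      ENNReal.ofReal (s ^ (a * q)) * ENNReal.ofReal |pdens ψ s (x + h) - pdens ψ s x| ^ q := by
  have hq1 : 0 < q - 1 := by linarith
  have hq0 : 0 < q := by linarith
  set r := q / (q - 1) with hr
  have hr0 : 0 < r := by positivity
  have hpq : r.HolderConjugate q := (Real.HolderConjugate.conjExponent (by linarith : 1 < q)).symm
  set A0 : ENNReal := ∫⁻ s in Ioc (0:ℝ) 1, ENNReal.ofReal (s ^ (-a)) ^ r with hA0
  have hA0t : A0 ≠ ⊤ := by
    have : A0 = ∫⁻ s in Ioc (0:ℝ) 1, ENNReal.ofReal (1 * s ^ (-a * r)) := by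
      refine setLIntegral_congr_fun measurableSet_Ioc fun s hs => ?_
      have := Real.rpow_nonneg hs.1.le (-a)
      rw [ENNReal.ofReal_rpow_of_nonneg this hr0.le, one_mul, ← Real.rpow_mul hs.1.le]
    rw [this, lint_rpow zero_le_one]
    · exact ENNReal.ofReal_ne_top
    · have : a * r < 1 := by
        rw [hr, mul_div_assoc', div_lt_one hq1]; exact ha
      linarith
  refine ⟨(A0 ^ (1 / r)) ^ q, ?_, fun h x => ?_⟩
  · exact ENNReal.rpow_ne_top_of_nonneg hq0.le
      (ENNReal.rpow_ne_top_of_nonneg (by positivity) hA0t)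
  · have hm : Measurable (fun s => ENNReal.ofReal |pdens ψ s (x + h) - pdens ψ s x|) :=
      H.meas_delta_s h x
    have hold := ENNReal.lintegral_mul_le_Lp_mul_Lq (volume.restrict (Ioc (0:ℝ) 1)) hpq
      (f := fun s => ENNReal.ofReal (s ^ (-a)))
      (g := fun s => ENNReal.ofReal (s ^ a) * ENNReal.ofReal |pdens ψ s (x + h) - pdens ψ s x|)
      (by fun_prop) ((by fun_prop : Measurable fun s : ℝ => ENNReal.ofReal (s ^ a)).mul hm).aemeasurable
    have e1 : WW ψ h x = ∫⁻ s in Ioc (0:ℝ) 1, ((fun s => ENNReal.ofReal (s ^ (-a))) *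
        fun s => ENNReal.ofReal (s ^ a) *
          ENNReal.ofReal |pdens ψ s (x + h) - pdens ψ s x|) s := by
      refine setLIntegral_congr_fun measurableSet_Ioc fun s hs => ?_
      simp only [Pi.mul_apply]
      have hs0 : 0 < s := hs.1
      rw [← mul_assoc, ← ENNReal.ofReal_mul (by positivity), ← Real.rpow_add hs0]
      simp
    have e2 : ∫⁻ s in Ioc (0:ℝ) 1, (ENNReal.ofReal (s ^ a) *
        ENNReal.ofReal |pdens ψ s (x + h) - pdens ψ s x|) ^ q = ∫⁻ s in Ioc (0:ℝ) 1,
      ENNReal.ofReal (s ^ (a * q)) * ENNReal.ofReal |pdens ψ s (x + h) - pdens ψ s x| ^ q := by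
      refine setLIntegral_congr_fun measurableSet_Ioc fun s hs => ?_
      have hs0 : 0 < s := hs.1
      rw [ENNReal.mul_rpow_of_nonneg _ _ hq0.le, ENNReal.ofReal_rpow_of_nonneg (by positivity) hq0.le,
        ← Real.rpow_mul hs0.le]
    rw [← e1, e2] at hold
    calc WW ψ h x ^ q ≤ _ := ENNReal.rpow_le_rpow hold hq0.le
      _ = _ := by
        rw [ENNReal.mul_rpow_of_nonneg _ _ hq0.le, ← ENNReal.rpow_mul _ (1 / q) q,
          one_div_mul_cancel hq0.ne', ENNReal.rpow_one]

lemma case_two (H : Hyp β ψ D₁ D₂ C₀) (hβ : β = 2) {q : ℝ} (hq : 2 ≤ q) :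
    ∃ C : ℝ, ∀ h : ℝ, 0 < h → h ≤ 1 →
      (∫ x : ℝ, vfun ψ h x ^ q) ≤ C * h / (h ^ (q - 1) * ψ (1 / h) ^ (q - 1)) := by
  have hq0 : 0 < q := by linarith
  set η := 1 / (8 * q) with hη
  have hη0 : 0 < η := by positivity
  have hηq : η * q = 1 / 8 := by rw [hη]; field_simp
  set a := 1 - 9 / (8 * q) with ha
  have haq : a * q = q - 9 / 8 := by rw [ha]; field_simp
  obtain ⟨K, hK, hb⟩ := H.delta_bounds (show 1 / β < 1 / 2 + η by rw [hβ]; linarith) hη0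
  obtain ⟨A, hA, hW⟩ := H.holder_WW hq (show a * q < q - 1 by linarith)
  have hC0 : 0 ≤ C₀ := by
    have := (H.hnonneg 1).trans (H.hC0 1)
    simpa using this
  refine ⟨A.toReal * (K ^ q * 8) * C₀ ^ (q - 1), fun h hh hh1 => ?_⟩
  have hψh : 0 < ψ (1 / h) := H.hpos _ (by positivity)
  have hA0 : 0 ≤ A.toReal := ENNReal.toReal_nonneg
  have hKh : 0 ≤ K * h := by positivity
  apply int_le_of_WW hq0.le (by positivity)
  have hmeas : Measurable (fun z : ℝ × ℝ => ENNReal.ofReal (z.2 ^ (a * q)) *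
      ENNReal.ofReal |pdens ψ z.2 (z.1 + h) - pdens ψ z.2 z.1| ^ q) := by
    refine Measurable.mul (by fun_prop) (Measurable.pow_const ?_ q)
    exact H.meas_delta_swap h
  have hin : ∀ s ∈ Ioc (0:ℝ) 1, ∫⁻ x, ENNReal.ofReal (s ^ (a * q)) *
      ENNReal.ofReal |pdens ψ s (x + h) - pdens ψ s x| ^ q ≤
        ENNReal.ofReal ((K * h) ^ q * s ^ (-(7 / 8 : ℝ))) := by
    intro s hs
    have hs0 : 0 < s := hs.1
    obtain ⟨b1, b2⟩ := hb s h hs.1 hs.2 hh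
    rw [lintegral_const_mul' _ _ ENNReal.ofReal_ne_top]
    have hm0 : 0 ≤ K * h * s ^ (-(2 * (1 / 2 + η))) := by positivity
    calc _ ≤ ENNReal.ofReal (s ^ (a * q)) * ∫⁻ x,
          ENNReal.ofReal (K * h * s ^ (-(2 * (1 / 2 + η)))) ^ (q - 1) *
          ENNReal.ofReal |pdens ψ s (x + h) - pdens ψ s x| := by
          refine mul_le_mul_right (lintegral_mono fun x => ?_) _
          have e : ∀ w : ENNReal, w ^ q = w ^ (q - 1) * w := fun w => by
            nth_rewrite 3 [← ENNReal.rpow_one w]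
            rw [← ENNReal.rpow_add_of_nonneg _ _ (by linarith) zero_le_one]
            congr 1; ring
          rw [e]
          refine mul_le_mul_left (ENNReal.rpow_le_rpow ?_ (by linarith)) _
          exact ENNReal.ofReal_le_ofReal (b1 x)
      _ ≤ ENNReal.ofReal (s ^ (a * q)) *
          (ENNReal.ofReal (K * h * s ^ (-(2 * (1 / 2 + η)))) ^ (q - 1) *
            ENNReal.ofReal (K * h * s ^ (-(1 / 2 + η) - η))) := by
          refine mul_le_mul_right ?_ _
          rw [lintegral_const_mul']
          · exact mul_le_mul_right b2 _
          · exact ENNReal.rpow_ne_top_of_nonneg (by linarith) ENNReal.ofReal_ne_top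
      _ = _ := by
          rw [ENNReal.ofReal_rpow_of_nonneg hm0 (by linarith), ← ENNReal.ofReal_mul (by positivity),
            ← ENNReal.ofReal_mul (by positivity)]
          congr 1
          rw [Real.mul_rpow hKh (by positivity), ← Real.rpow_mul hs0.le]
          have e1 : (K * h) ^ q = (K * h) ^ (q - 1) * (K * h) := by
            rw [Real.rpow_sub_one (by positivity)]; field_simp
          have e2 : s ^ (-(7 / 8 : ℝ)) = s ^ (a * q) * s ^ (-(2 * (1 / 2 + η)) * (q - 1)) *
              s ^ (-(1 / 2 + η) - η) := by
            rw [← Real.rpow_add hs0, ← Real.rpow_add hs0]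
            congr 1
            rw [haq]
            linear_combination 2 * hηq
          rw [e1, e2]
          ring
  calc ∫⁻ x, WW ψ h x ^ q ≤ ∫⁻ x, A * ∫⁻ s in Ioc (0:ℝ) 1, ENNReal.ofReal (s ^ (a * q)) *
          ENNReal.ofReal |pdens ψ s (x + h) - pdens ψ s x| ^ q := lintegral_mono fun x => hW h x
    _ = A * ∫⁻ x, ∫⁻ s in Ioc (0:ℝ) 1, ENNReal.ofReal (s ^ (a * q)) *
          ENNReal.ofReal |pdens ψ s (x + h) - pdens ψ s x| ^ q := lintegral_const_mul' _ _ hA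
    _ = A * ∫⁻ s in Ioc (0:ℝ) 1, ∫⁻ x, ENNReal.ofReal (s ^ (a * q)) *
          ENNReal.ofReal |pdens ψ s (x + h) - pdens ψ s x| ^ q := by
        congr 1
        exact lintegral_lintegral_swap hmeas.aemeasurable
    _ ≤ A * ∫⁻ s in Ioc (0:ℝ) 1, ENNReal.ofReal ((K * h) ^ q * s ^ (-(7 / 8 : ℝ))) :=
        mul_le_mul_right (setLIntegral_mono' measurableSet_Ioc hin) _
    _ = ENNReal.ofReal (A.toReal * ((K * h) ^ q * 8)) := by
        rw [lint_rpow (by positivity) (by norm_num), ENNReal.ofReal_mul hA0,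
          ENNReal.ofReal_toReal hA]
        norm_num
    _ ≤ _ := by
        apply ENNReal.ofReal_le_ofReal
        rw [le_div_iff₀ (by positivity), Real.mul_rpow hK.le hh.le]
        have hq2 : h ^ 2 * ψ (1 / h) ≤ C₀ := by
          calc _ ≤ h ^ 2 * (C₀ * (1 / h) ^ 2) := by
                have := H.hC0 (1 / h)
                gcongr
            _ = C₀ := by field_simp
        have e1 : h ^ q = h * h ^ (q - 1) := by
          rw [Real.rpow_sub_one hh.ne']; field_simp
        have e2 : h ^ (q - 1) * (h ^ (q - 1) * ψ (1 / h) ^ (q - 1)) =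
            (h ^ 2 * ψ (1 / h)) ^ (q - 1) := by
          rw [← mul_assoc, ← Real.mul_rpow hh.le hh.le, ← Real.mul_rpow (by positivity) hψh.le]
          congr 2; ring
        have h3 : (h ^ 2 * ψ (1 / h)) ^ (q - 1) ≤ C₀ ^ (q - 1) :=
          Real.rpow_le_rpow (by positivity) hq2 (by linarith)
        calc _ = A.toReal * (K ^ q * 8) * h *
              (h ^ (q - 1) * (h ^ (q - 1) * ψ (1 / h) ^ (q - 1))) := by rw [e1]; ring
          _ ≤ A.toReal * (K ^ q * 8) * h * C₀ ^ (q - 1) := by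
              rw [e2]
              exact mul_le_mul_of_nonneg_left h3 (by positivity)
          _ = _ := by ring

end Hyp


end helpers

theorem stmt_5
    (β : ℝ) (hβ1 : 1 < β) (hβ2 : β ≤ 2)
    (ψ : ℝ → ℝ)
    (hmeas : Measurable ψ)
    (heven : ∀ p : ℝ, ψ (-p) = ψ p)
    (hnonneg : ∀ p : ℝ, 0 ≤ ψ p)
    (hpos : ∀ p : ℝ, p ≠ 0 → 0 < ψ p)
    (hRV : ∀ l : ℝ, 0 < l →
      Filter.Tendsto (fun x => ψ (l * x) / ψ x) Filter.atTop (nhds (l ^ β)))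
    (hdiff1 : ∀ p : ℝ, 0 < p → DifferentiableAt ℝ ψ p)
    (hdiff2 : ∀ p : ℝ, 0 < p → DifferentiableAt ℝ (deriv ψ) p)
    (D₁ D₂ : ℝ)
    (hD1 : ∀ l : ℝ, 1 ≤ l → l * |deriv ψ l| ≤ D₁ * ψ l)
    (hD2 : ∀ l : ℝ, 1 ≤ l → l ^ 2 * |deriv (deriv ψ) l| ≤ D₂ * ψ l)
    (hint1 : MeasureTheory.IntegrableOn (fun l : ℝ => (deriv ψ l) ^ 2) (Set.Ioc (0:ℝ) 1))
    (hint2 : MeasureTheory.IntegrableOn (fun l : ℝ => |deriv (deriv ψ) l|) (Set.Ioc (0:ℝ) 1))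
    (hint3 : MeasureTheory.IntegrableOn (fun l : ℝ => ψ l / l) (Set.Ioc (0:ℝ) 1))
    (C₀ : ℝ) (hC0 : ∀ p : ℝ, ψ p ≤ C₀ * p ^ 2)
    (hliminf : 0 < Filter.liminf (fun p : ℝ => ψ p / p ^ 2) (nhdsWithin (0:ℝ) ({0}ᶜ))) :
    ∀ q : ℝ, 2 ≤ q → ∃ C h₀ : ℝ, 0 < h₀ ∧ ∀ h : ℝ, 0 < h → h ≤ h₀ →
      (∫ x : ℝ, vfun ψ h x ^ q) ≤ C * h / (h ^ (q - 1) * ψ (1 / h) ^ (q - 1)) := by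
  have H : Hyp β ψ D₁ D₂ C₀ := ⟨hβ1, hmeas, hnonneg, hpos, hRV, hdiff1, hdiff2, hD1, hD2,
    hint1, hint2, hC0⟩
  intro q hq
  rcases hβ2.lt_or_eq with hlt | heq
  · obtain ⟨C, hC⟩ := H.case_lt hlt hq
    exact ⟨C, 1, one_pos, hC⟩
  · obtain ⟨C, hC⟩ := H.case_two heq hq
    exact ⟨C, 1, one_pos, hC⟩
end
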